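/- Elliptic regularity in Morrey spaces for the Hodge system: if u is a 1-form and φ a 2-form on [0,1]ⁿ satisfying ∂^β u^α − ∂^α u^β = φ^{αβ} and ∂_α u^α = 0 in [0,1]ⁿ, with the boundary condition n_α u^α = 0 on ∂[0,1]ⁿ, then ‖u‖_{M^q_{2,1}([0,1]ⁿ)} ≤ C_q ‖φ‖_{M^q_2([0,1]ⁿ)} for any 1 < q < ∞. -/

import Mathlib

open MeasureTheory Metric

noncomputable def morreyNorm (n : ℕ) (p q : ℝ) (Ω : Set (EuclideanSpace ℝ (Fin n)))
    (f : EuclideanSpace ℝ (Fin n) → ℝ) : ℝ :=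
  ⨆ x₀ : EuclideanSpace ℝ (Fin n), ⨆ r : Set.Ioc (0:ℝ) 1,
    (r : ℝ) ^ ((n : ℝ) * (1/p - 1/q)) *
      (∫ y in Metric.ball x₀ (r : ℝ) ∩ Ω, |f y| ^ q) ^ (1/q)

/-- The unit cube [0,1]ⁿ. -/
def unitCube (n : ℕ) : Set (EuclideanSpace ℝ (Fin n)) :=
  {x | ∀ i, x i ∈ Set.Icc (0:ℝ) 1}

/-- Standard basis vector. -/
noncomputable def stdVec (n : ℕ) (i : Fin n) : EuclideanSpace ℝ (Fin n) :=
  EuclideanSpace.single i (1:ℝ)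

namespace MH

/-- Partial derivative. -/
noncomputable def pd {n : ℕ} (f : EuclideanSpace ℝ (Fin n) → ℝ) (β : Fin n) :
    EuclideanSpace ℝ (Fin n) → ℝ := fun x => fderiv ℝ f x (stdVec n β)

/-- Averaging operator. -/
noncomputable def T {n : ℕ} (κ f : EuclideanSpace ℝ (Fin n) → ℝ) (s : ℝ)
    (x : EuclideanSpace ℝ (Fin n)) : ℝ := ∫ y, κ y * f (x - s • y)

/-- Smooth function. -/
def Sm {n : ℕ} (f : EuclideanSpace ℝ (Fin n) → ℝ) : Prop := ContDiff ℝ (⊤ : ℕ∞) f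

/-- Kernel. -/
def Ker {n : ℕ} (κ : EuclideanSpace ℝ (Fin n) → ℝ) : Prop := Sm κ ∧ tsupport κ ⊆ ball 0 1

variable {n : ℕ}

local notation "E" => EuclideanSpace ℝ (Fin n)

lemma Sm.pd {f : E → ℝ} (hf : Sm f) (β : Fin n) : Sm (pd f β) := by
  unfold Sm MH.pd at *
  exact (hf.fderiv_right (m := (⊤ : ℕ∞)) (by simp)).clm_apply contDiff_const

lemma Sm.cont {f : E → ℝ} (hf : Sm f) : Continuous f := ContDiff.continuous hf

lemma Sm.diff {f : E → ℝ} (hf : Sm f) : Differentiable ℝ f :=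
  ContDiff.differentiable hf (by simp)

lemma Ker.pd {κ : E → ℝ} (hκ : Ker κ) (β : Fin n) : Ker (pd κ β) := by
  refine ⟨hκ.1.pd β, ?_⟩
  refine Set.Subset.trans (closure_minimal ?_ (isClosed_tsupport κ)) hκ.2
  refine Set.Subset.trans ?_ (support_fderiv_subset ℝ (f := κ))
  intro x hx h
  apply hx
  simp only [MH.pd]
  simp [h]

lemma coord_sm (β : Fin n) : Sm (fun y : E => y β) := by
  unfold Sm; fun_prop

lemma Ker.mulc {κ : E → ℝ} (hκ : Ker κ) (β : Fin n) : Ker (fun y => κ y * y β) := by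
  refine ⟨ContDiff.mul hκ.1 (coord_sm β), ?_⟩
  exact (tsupport_mul_subset_left (f := κ) (g := fun y => y β)).trans hκ.2

lemma Ker.cpt {κ : E → ℝ} (hκ : Ker κ) : HasCompactSupport κ :=
  HasCompactSupport.of_support_subset_isCompact (isCompact_closedBall (0:E) 1)
    ((subset_tsupport κ).trans (hκ.2.trans ball_subset_closedBall))

lemma Ker.zero {κ : E → ℝ} (hκ : Ker κ) {y : E} (hy : 1 ≤ ‖y‖) : κ y = 0 := by
  by_contra h
  have := hκ.2 (subset_tsupport κ h)
  simp at this; linarith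

lemma vec_expand (v : E) : v = ∑ β, v β • stdVec n β := by
  ext i
  simp [stdVec, Finset.sum_apply, Pi.single_apply]

lemma lin_expand (f : E → ℝ) (x v : E) : fderiv ℝ f x v = ∑ β, v β * pd f β x := by
  conv_lhs => rw [vec_expand v]
  rw [map_sum]
  simp [pd]

lemma hasDeriv_gen {κ f : E → ℝ} (hκ : Continuous κ) (hc : HasCompactSupport κ)
    (hf : ContDiff ℝ 1 f) {a b : E → E} (ha : Continuous a) (hb : Continuous b) (t0 : ℝ) :
    HasDerivAt (fun t => ∫ y, κ y * f (a y + t • b y))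
      (∫ y, κ y * fderiv ℝ f (a y + t0 • b y) (b y)) t0 := by
  have hcf : Continuous (fderiv ℝ f) := hf.continuous_fderiv (by simp)
  have hdf : Differentiable ℝ f := hf.differentiable (by simp)
  set F' : ℝ → E → ℝ := fun t y => κ y * fderiv ℝ f (a y + t • b y) (b y) with hF'
  have hF'c : Continuous (fun p : ℝ × E => F' p.1 p.2) := by
    simp only [hF']
    have h1 : Continuous (fun p : ℝ × E => fderiv ℝ f (a p.2 + p.1 • b p.2)) := by fun_prop
    exact (hκ.comp continuous_snd).mul (h1.clm_apply (hb.comp continuous_snd))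
  obtain ⟨C, hC⟩ := ((isCompact_closedBall t0 1).prod hc.isCompact).exists_bound_of_continuousOn
    (f := fun p : ℝ × E => F' p.1 p.2) hF'c.continuousOn
  refine (hasDerivAt_integral_of_dominated_loc_of_deriv_le (F' := F')
    (bound := (tsupport κ).indicator (fun _ => C)) (ball_mem_nhds t0 one_pos)
    ?_ ?_ ?_ ?_ ?_ ?_).2
  · refine Filter.Eventually.of_forall fun t => ?_
    exact Continuous.aestronglyMeasurable (by fun_prop)
  · refine Continuous.integrable_of_hasCompactSupport (by fun_prop) ?_
    exact hc.mul_right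
  · exact Continuous.aestronglyMeasurable (hF'c.comp (by fun_prop : Continuous fun y : E => (t0, y)))
  · refine Filter.Eventually.of_forall fun y t ht => ?_
    by_cases hy : y ∈ tsupport κ
    · rw [Set.indicator_of_mem hy]
      exact hC (t, y) ⟨ball_subset_closedBall ht, hy⟩
    · rw [Set.indicator_of_notMem hy]
      simp [hF', image_eq_zero_of_notMem_tsupport hy]
  · refine (integrable_indicator_iff hc.isCompact.measurableSet).2 ?_
    exact integrableOn_const hc.isCompact.measure_lt_top.ne
  · refine Filter.Eventually.of_forall fun y t ht => ?_
    refine HasDerivAt.const_mul (κ y) ?_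
    have h1 : HasDerivAt (fun t : ℝ => a y + t • b y) (b y) t := by
      simpa using ((hasDerivAt_id t).smul_const (b y)).const_add (a y)
    exact (hdf _).hasFDerivAt.comp_hasDerivAt t h1

lemma int_cpt {κ g : E → ℝ} (hκ : Continuous κ) (hc : HasCompactSupport κ) (hg : Continuous g) :
    Integrable (fun y => κ y * g y) :=
  Continuous.integrable_of_hasCompactSupport (by fun_prop) hc.mul_right

lemma T_hasDeriv_s {κ f : E → ℝ} (hκ : Continuous κ) (hc : HasCompactSupport κ)
    (hf : Sm f) (x : E) (s : ℝ) :
    HasDerivAt (fun s => T κ f s x) (- ∑ β, T (fun y => κ y * y β) (pd f β) s x) s := by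
  have h := hasDeriv_gen hκ hc (hf.of_le (by simp)) (a := fun _ => x) (b := fun y => -y)
    continuous_const continuous_neg s
  have e : (fun t => ∫ y, κ y * f (x + t • -y)) = fun s => T κ f s x := by
    funext t; simp [T, sub_eq_add_neg]
  rw [e] at h
  convert h using 1
  simp only [T]
  rw [← Finset.sum_neg_distrib]
  simp_rw [← integral_neg]
  rw [← integral_finsetSum]
  · congr 1; funext y
    rw [lin_expand, Finset.mul_sum]
    refine Finset.sum_congr rfl fun β _ => ?_
    simp [sub_eq_add_neg]; ring
  · intro β _
    have := (hf.pd β).cont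
    exact (int_cpt (by fun_prop) hc.mul_right (by fun_prop)).neg

lemma T_smooth {κ f : E → ℝ} (hκ : Ker κ) {s : ℝ} (hs : s ≠ 0) (hf : Continuous f) :
    Sm (T κ f s) := by
  have h : Sm (convolution κ (fun z => f (s • z)) (ContinuousLinearMap.lsmul ℝ ℝ) volume) := by
    refine HasCompactSupport.contDiff_convolution_left _ hκ.cpt hκ.1 ?_
    exact Continuous.locallyIntegrable (by fun_prop)
  have e : T κ f s = fun x =>
      convolution κ (fun z => f (s • z)) (ContinuousLinearMap.lsmul ℝ ℝ) volume (s⁻¹ • x) := by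
    funext x
    simp [T, convolution, smul_sub, smul_smul, hs]
  rw [e]
  exact ContDiff.comp (g := convolution κ (fun z => f (s • z)) (ContinuousLinearMap.lsmul ℝ ℝ) volume)
    h (contDiff_const_smul _)

lemma pd_of_hasDeriv {f : E → ℝ} (hf : DifferentiableAt ℝ f x) {β : Fin n} {d : ℝ}
    (h : HasDerivAt (fun t : ℝ => f (x + t • stdVec n β)) d 0) : pd f β x = d := by
  have h1 : HasDerivAt (fun t : ℝ => x + t • stdVec n β) (stdVec n β) 0 := by
    simpa using ((hasDerivAt_id (0:ℝ)).smul_const (stdVec n β)).const_add x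
  have h2 : HasFDerivAt f (fderiv ℝ f x) (x + (0:ℝ) • stdVec n β) := by
    simpa using hf.hasFDerivAt
  exact (h2.comp_hasDerivAt (0:ℝ) h1).unique h

lemma pd_T {κ f : E → ℝ} (hκ : Ker κ) {s : ℝ} (hs : s ≠ 0) (hf : Sm f) (β : Fin n) :
    pd (T κ f s) β = T κ (pd f β) s := by
  funext x
  refine pd_of_hasDeriv ((T_smooth hκ hs hf.cont).diff x) ?_
  have h := hasDeriv_gen hκ.1.cont hκ.cpt (hf.of_le (by simp)) (a := fun y => x - s • y)
    (b := fun _ => stdVec n β) (by fun_prop) continuous_const 0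
  have e : (fun t : ℝ => ∫ y, κ y * f (x - s • y + t • stdVec n β)) =
      fun t : ℝ => T κ f s (x + t • stdVec n β) := by
    funext t; simp only [T]; congr 1; funext y; congr 2; abel
  rw [e] at h
  simpa [T, pd] using h

lemma T_ibp {κ f : E → ℝ} (hκ : Continuous κ) (hκd : Differentiable ℝ κ)
    (hc : HasCompactSupport κ) (β : Fin n) (hp : Continuous (pd κ β))
    (hf : Sm f) (s : ℝ) (x : E) :
    s * T κ (pd f β) s x = T (pd κ β) f s x := by
  have hd : ∀ y, HasFDerivAt (fun y : E => f (x - s • y))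
      ((fderiv ℝ f (x - s • y)).comp (-(s • ContinuousLinearMap.id ℝ E))) y := by
    intro y
    have h1 : HasFDerivAt (fun y : E => x - s • y) (-(s • ContinuousLinearMap.id ℝ E)) y :=
      ((hasFDerivAt_id y).const_smul s).const_sub x
    exact (hf.diff _).hasFDerivAt.comp y h1
  have hpd : ∀ y, fderiv ℝ (fun y : E => f (x - s • y)) y (stdVec n β) =
      - s * pd f β (x - s • y) := by
    intro y; rw [(hd y).fderiv]; simp [pd]
  have hpc := (hf.pd β).cont
  have hfc := hf.cont
  have hc' : HasCompactSupport (pd κ β) := by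
    refine HasCompactSupport.of_support_subset_isCompact hc.isCompact ?_
    refine Set.Subset.trans ?_ (support_fderiv_subset ℝ (f := κ))
    intro x hx h
    apply hx
    simp only [MH.pd]
    simp [h]
  have h := integral_mul_fderiv_eq_neg_fderiv_mul_of_integrable (μ := (volume : Measure E))
    (f := κ) (g := fun y => f (x - s • y)) (v := stdVec n β)
    (int_cpt hp hc' (by fun_prop)) (by simp_rw [hpd]; exact int_cpt hκ hc (by fun_prop))
    (int_cpt hκ hc (by fun_prop)) (fun y _ => hκd y) (fun y _ => (hd y).differentiableAt)
  simp_rw [hpd] at h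
  have e : ∀ y, κ y * (-s * pd f β (x - s • y)) = - (s * (κ y * pd f β (x - s • y))) :=
    fun y => by ring
  simp_rw [e] at h
  rw [integral_neg, integral_const_mul] at h
  simpa [T, pd] using neg_injective h

lemma pd_comm {f : E → ℝ} (hf : Sm f) (α β : Fin n) (x : E) :
    pd (pd f α) β x = pd (pd f β) α x := by
  have h2 : ContDiffAt ℝ 2 f x := (ContDiff.of_le hf (WithTop.coe_le_coe.2 (le_top : (2:ℕ∞) ≤ ⊤))).contDiffAt
  have hs := h2.isSymmSndFDerivAt (by simp)
  have hd : DifferentiableAt ℝ (fderiv ℝ f) x :=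
    (ContDiff.fderiv_right hf (m := 1) (WithTop.coe_le_coe.2 (le_top : (1+1:ℕ∞) ≤ ⊤))).differentiable (by simp) x
  have key : ∀ a b : Fin n, pd (pd f a) b x = fderiv ℝ (fderiv ℝ f) x (stdVec n b) (stdVec n a) := by
    intro a b
    have := (hd.hasFDerivAt.clm_apply (hasFDerivAt_const (stdVec n a) x)).fderiv
    change fderiv ℝ (fun y => (fderiv ℝ f y) (stdVec n a)) x (stdVec n b) = _
    rw [this]
    simp
  rw [key, key]
  exact hs _ _



lemma exists_kernel (hn : 0 < n) : ∃ ρ Ψ : E → ℝ, Ker ρ ∧ Sm Ψ ∧ HasCompactSupport Ψ ∧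
    ∫ y, ρ y = 1 ∧ ∀ β y, pd Ψ β y = -(ρ y * y β) := by
  set h : ℝ → ℝ := fun t => Real.smoothTransition (1 - 4 * t) with hh
  have hsm : ContDiff ℝ (⊤ : ℕ∞) h := Real.smoothTransition.contDiff.comp (by fun_prop)
  have hsm' : ContDiff ℝ (⊤ : ℕ∞) (deriv h) := by
    have := (contDiff_infty_iff_deriv (𝕜 := ℝ) (f := h)).1 hsm
    exact this.2
  have hanti : Antitone h := fun a b hab => Real.smoothTransition.monotone (by linarith)
  have hzero : ∀ t, 1/4 ≤ t → h t = 0 := fun t ht =>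
    Real.smoothTransition.zero_of_nonpos (by linarith)
  have hd0 : ∀ t, 1/4 < t → deriv h t = 0 := by
    intro t ht
    have : h =ᶠ[nhds t] fun _ => 0 := by
      filter_upwards [lt_mem_nhds ht] with s hs using hzero s hs.le
    rw [this.deriv_eq]; simp
  set Ψ0 : E → ℝ := fun y => h (‖y‖^2) with hΨ0
  set ρ0 : E → ℝ := fun y => -2 * deriv h (‖y‖^2) with hρ0
  have hΨs : Sm Ψ0 := hsm.comp (contDiff_norm_sq ℝ)
  have hρs : Sm ρ0 := contDiff_const.mul (hsm'.comp (contDiff_norm_sq ℝ))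
  have hpd : ∀ β y, pd Ψ0 β y = -(ρ0 y * y β) := by
    intro β y
    have h1 : HasFDerivAt (fun y : E => ‖y‖^2) (2 • (innerSL ℝ y)) y :=
      (hasStrictFDerivAt_norm_sq y).hasFDerivAt
    have h2 : HasDerivAt h (deriv h (‖y‖^2)) (‖y‖^2) :=
      ((hsm.differentiable (by simp)) _).hasDerivAt
    have h3 := h2.comp_hasFDerivAt y h1
    have : fderiv ℝ Ψ0 y = _ := h3.fderiv
    simp only [pd, this, hρ0]
    simp [stdVec, innerSL_apply_apply, EuclideanSpace.inner_single_right]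
    ring
  have hρsupp : tsupport ρ0 ⊆ ball 0 1 := by
    have : tsupport ρ0 ⊆ closedBall 0 (1/2) := by
      refine closure_minimal ?_ isClosed_closedBall
      intro y hy
      by_contra hcon
      apply hy
      simp only [mem_closedBall, dist_zero_right, not_le] at hcon
      have : 1/4 < ‖y‖^2 := by nlinarith
      simp [hρ0, hd0 _ this]
    exact this.trans (closedBall_subset_ball (by norm_num))
  have hΨc : HasCompactSupport Ψ0 := by
    refine HasCompactSupport.of_support_subset_isCompact (isCompact_closedBall (0:E) (1/2)) ?_
    intro y hy
    by_contra hcon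
    apply hy
    simp only [mem_closedBall, dist_zero_right, not_le] at hcon
    have : 1/4 ≤ ‖y‖^2 := by nlinarith
    exact hzero _ this
  have hK0 : Ker ρ0 := ⟨hρs, hρsupp⟩
  have hnn : ∀ y, 0 ≤ ρ0 y := fun y => by
    have : deriv h (‖y‖^2) ≤ 0 := hanti.deriv_nonpos
    simp only [hρ0]; nlinarith
  have hint : Integrable ρ0 := hρs.cont.integrable_of_hasCompactSupport hK0.cpt
  have hne : ∫ y, ρ0 y ≠ 0 := by
    intro h0
    have h1 := (integral_eq_zero_iff_of_nonneg hnn hint).1 h0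
    have h2 : ρ0 = 0 := (hρs.cont.ae_eq_iff_eq volume continuous_const).1 h1
    have h3 : ∀ y, fderiv ℝ Ψ0 y = 0 := by
      intro y; ext v
      rw [lin_expand]
      simp [hpd, h2]
    have h4 := is_const_of_fderiv_eq_zero hΨs.diff h3 0 (stdVec n ⟨0, hn⟩)
    simp [hΨ0, hh, stdVec] at h4
    rw [Real.smoothTransition.zero_of_nonpos (by norm_num)] at h4
    exact one_ne_zero h4
  set c := (∫ y, ρ0 y)⁻¹ with hc
  refine ⟨fun y => c * ρ0 y, fun y => c * Ψ0 y, ⟨contDiff_const.mul hρs, ?_⟩, contDiff_const.mul hΨs,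
    hΨc.mul_left, ?_, ?_⟩
  · exact (tsupport_mul_subset_right (f := fun _ => c) (g := ρ0)).trans hρsupp
  · rw [integral_const_mul, hc, inv_mul_cancel₀ hne]
  · intro β y
    have : pd (fun y => c * Ψ0 y) β y = c * pd Ψ0 β y := by
      simp only [pd]
      rw [fderiv_const_mul (hΨs.diff y)]; simp
    rw [this, hpd]; ring

/-- curl -/
noncomputable def cu (u : Fin n → E → ℝ) (α β : Fin n) : E → ℝ :=
  fun z => pd (u α) β z - pd (u β) α z

lemma Sm.sub {f g : E → ℝ} (hf : Sm f) (hg : Sm g) : Sm (fun x => f x - g x) := ContDiff.sub hf hg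

lemma cu_sm {u : Fin n → E → ℝ} (hu : ∀ α, Sm (u α)) (α β : Fin n) : Sm (cu u α β) :=
  ((hu α).pd β).sub ((hu β).pd α)

lemma T_sub {κ f g : E → ℝ} (hκ : Continuous κ) (hc : HasCompactSupport κ) (hf : Continuous f)
    (hg : Continuous g) (s : ℝ) (x : E) :
    T κ (fun z => f z - g z) s x = T κ f s x - T κ g s x := by
  simp only [T]
  rw [← integral_sub (int_cpt hκ hc (by fun_prop)) (int_cpt hκ hc (by fun_prop))]
  congr 1; funext y; ring

lemma T_sum {ι : Type*} (S : Finset ι) {κ : E → ℝ} {f : ι → E → ℝ} (hκ : Continuous κ)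
    (hc : HasCompactSupport κ) (hf : ∀ i, Continuous (f i)) (s : ℝ) (x : E) :
    T κ (fun z => ∑ i ∈ S, f i z) s x = ∑ i ∈ S, T κ (f i) s x := by
  simp only [T]
  rw [← integral_finsetSum]
  · congr 1; funext y; rw [Finset.mul_sum]
  · intro i _
    have := hf i
    exact int_cpt hκ hc (by fun_prop)

lemma pd_sum {ι : Type*} (S : Finset ι) {f : ι → E → ℝ} (hf : ∀ i, Sm (f i)) (β : Fin n) (x : E) :
    pd (fun z => ∑ i ∈ S, f i z) β x = ∑ i ∈ S, pd (f i) β x := by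
  simp only [pd]
  rw [fderiv_fun_sum (fun i _ => (hf i).diff x)]
  simp

lemma pd_sub {f g : E → ℝ} (hf : Sm f) (hg : Sm g) (β : Fin n) (x : E) :
    pd (fun z => f z - g z) β x = pd f β x - pd g β x := by
  simp only [pd]
  rw [fderiv_fun_sub (hf.diff x) (hg.diff x)]
  simp

lemma div_pd {u : Fin n → E → ℝ} (hu : ∀ α, Sm (u α)) (hdiv : ∀ x, ∑ α, pd (u α) α x = 0)
    (γ : Fin n) (x : E) : ∑ α, pd (pd (u α) γ) α x = 0 := by
  have h1 : ∀ α, pd (pd (u α) γ) α x = pd (pd (u α) α) γ x := fun α => pd_comm (hu α) _ _ _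
  simp_rw [h1]
  rw [← pd_sum _ (fun α => (hu α).pd α)]
  have : (fun z => ∑ i, pd (u i) i z) = fun _ => 0 := funext hdiv
  rw [this]; simp [pd]

lemma ode {ρ Ψ : E → ℝ} (hρ : Ker ρ) (hΨ : Sm Ψ) (hΨc : HasCompactSupport Ψ)
    (hpd : ∀ β y, pd Ψ β y = -(ρ y * y β)) {u : Fin n → E → ℝ} (hu : ∀ α, Sm (u α))
    (hdiv : ∀ x, ∑ α, pd (u α) α x = 0) (α : Fin n) (x : E) (s : ℝ) :
    HasDerivAt (fun s => T ρ (u α) s x) (- ∑ β, T (fun y => ρ y * y β) (cu u α β) s x) s := by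
  convert T_hasDeriv_s hρ.1.cont hρ.cpt (hu α) x s using 2
  have h1 : ∀ β, T (fun y => ρ y * y β) (cu u α β) s x =
      T (fun y => ρ y * y β) (pd (u α) β) s x - T (fun y => ρ y * y β) (pd (u β) α) s x :=
    fun β => T_sub (hρ.mulc β).1.cont (hρ.mulc β).cpt ((hu α).pd β).cont ((hu β).pd α).cont s x
  simp_rw [h1]
  rw [Finset.sum_sub_distrib, sub_eq_self]
  have h2 : ∀ β, T (fun y => ρ y * y β) (pd (u β) α) s x = -(s * T Ψ (pd (pd (u β) α) β) s x) := by
    intro β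
    rw [T_ibp hΨ.cont hΨ.diff hΨc β (hΨ.pd β).cont ((hu β).pd α)]
    have : pd Ψ β = fun y => -(ρ y * y β) := funext (hpd β)
    rw [this]
    simp [T, integral_neg]
  simp_rw [h2]
  rw [Finset.sum_neg_distrib, ← Finset.mul_sum, ← T_sum _ hΨ.cont hΨc
    (fun β => (((hu β).pd α).pd β).cont)]
  have : (fun z => ∑ i, pd (pd (u i) α) i z) = fun _ => 0 := funext (div_pd hu hdiv α)
  rw [this]; simp [T]

lemma T_cont_s {κ f : E → ℝ} (hκ : Ker κ) (hf : Sm f) (x : E) : Continuous (fun s => T κ f s x) :=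
  continuous_iff_continuousAt.2 fun s => (T_hasDeriv_s hκ.1.cont hκ.cpt hf x s).continuousAt

lemma T_zero {ρ f : E → ℝ} (h1 : ∫ y, ρ y = 1) (x : E) : T ρ f 0 x = f x := by
  simp [T, integral_mul_const, h1]

lemma ftc {ρ Ψ : E → ℝ} (hρ : Ker ρ) (hΨ : Sm Ψ) (hΨc : HasCompactSupport Ψ)
    (hpd : ∀ β y, pd Ψ β y = -(ρ y * y β)) {u : Fin n → E → ℝ} (hu : ∀ α, Sm (u α))
    (hdiv : ∀ x, ∑ α, pd (u α) α x = 0) (α : Fin n) (x : E) (a b : ℝ) :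
    T ρ (u α) a x - T ρ (u α) b x = ∑ β, ∫ t in a..b, T (fun y => ρ y * y β) (cu u α β) t x := by
  have hc : ∀ β, Continuous (fun t => T (fun y => ρ y * y β) (cu u α β) t x) := fun β =>
    T_cont_s (hρ.mulc β) (cu_sm hu α β) x
  have := intervalIntegral.integral_eq_sub_of_hasDerivAt
    (fun s _ => ode hρ hΨ hΨc hpd hu hdiv α x s)
    ((continuous_finsetSum _ fun β _ => hc β).neg.intervalIntegrable a b)
  rw [intervalIntegral.integral_neg, intervalIntegral.integral_finsetSum
    (fun β _ => (hc β).intervalIntegrable a b)] at this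
  linarith



/-- local L2 mass -/
noncomputable def L2 (f : E → ℝ) (z : E) (r : ℝ) : ENNReal := ∫⁻ x in ball z r, ‖f x‖ₑ ^ 2

lemma cs {Y : Type*} [MeasurableSpace Y] (ν : Measure Y) {g : Y → ENNReal} (hg : AEMeasurable g ν) :
    (∫⁻ y, g y ∂ν) ^ 2 ≤ ν Set.univ * ∫⁻ y, g y ^ 2 ∂ν := by
  have h := ENNReal.lintegral_mul_le_Lp_mul_Lq ν Real.HolderConjugate.two_two
    (f := fun _ => 1) (g := g) aemeasurable_const hg
  simp only [Pi.mul_apply, one_mul, ENNReal.one_rpow, lintegral_const] at h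
  have h2 := pow_le_pow_left' h 2
  refine h2.trans (le_of_eq ?_)
  rw [mul_pow, ← ENNReal.rpow_natCast, ← ENNReal.rpow_natCast, ← ENNReal.rpow_mul,
    ← ENNReal.rpow_mul]
  norm_num

lemma L2_shift (f : E → ℝ) (z a : E) (r : ℝ) :
    ∫⁻ x in ball z r, ‖f (x - a)‖ₑ ^ 2 = L2 f (z - a) r := by
  unfold L2
  have h := (measurePreserving_sub_right (volume : Measure E) a).setLIntegral_comp_preimage_emb
    (MeasurableEquiv.subRight a).measurableEmbedding (fun x => ‖f x‖ₑ ^ 2) (ball (z - a) r)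
  rw [← h]
  congr 2
  ext x; simp [dist_eq_norm]

lemma conv_L2 {Y : Type*} [MeasurableSpace Y] (ν : Measure Y) [SFinite ν] {a : Y → E}
    (ha : Measurable a) {f : E → ℝ} (hf : Measurable f) {R : ℝ} {M : ENNReal}
    (hM : ∀ z, L2 f z R ≤ M) {g : E → ℝ} {K : ENNReal}
    (hg : ∀ x, ‖g x‖ₑ ≤ K * ∫⁻ y, ‖f (x - a y)‖ₑ ∂ν) (z : E) :
    L2 g z R ≤ K ^ 2 * (ν Set.univ) ^ 2 * M := by
  have hmeas : Measurable (fun p : E × Y => ‖f (p.1 - a p.2)‖ₑ ^ 2) := by fun_prop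
  calc L2 g z R ≤ ∫⁻ x in ball z R, K ^ 2 * ν Set.univ * ∫⁻ y, ‖f (x - a y)‖ₑ ^ 2 ∂ν := by
        refine lintegral_mono fun x => ?_
        refine (pow_le_pow_left' (hg x) 2).trans ?_
        rw [mul_pow, mul_assoc]
        gcongr
        exact cs ν (by fun_prop)
    _ = K ^ 2 * ν Set.univ * ∫⁻ x in ball z R, ∫⁻ y, ‖f (x - a y)‖ₑ ^ 2 ∂ν := by
        rw [lintegral_const_mul]
        exact hmeas.lintegral_prod_right'
    _ = K ^ 2 * ν Set.univ * ∫⁻ y, (∫⁻ x in ball z R, ‖f (x - a y)‖ₑ ^ 2) ∂ν := by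
        rw [lintegral_lintegral_swap]
        exact hmeas.aemeasurable
    _ ≤ K ^ 2 * ν Set.univ * ∫⁻ y, M ∂ν := by
        gcongr with y
        rw [L2_shift]; exact hM _
    _ = _ := by rw [lintegral_const]; ring

lemma Ker.bound {κ : E → ℝ} (hκ : Ker κ) : ∃ K : NNReal, ∀ y, ‖κ y‖ₑ ≤ K := by
  obtain ⟨C, hC⟩ := hκ.cpt.exists_bound_of_continuous hκ.1.cont
  refine ⟨C.toNNReal, fun y => ?_⟩
  rw [← ofReal_norm]
  exact ENNReal.ofReal_le_ofReal (hC y)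

lemma T_enorm {κ : E → ℝ} (hκ : Ker κ) {K : NNReal} (hK : ∀ y, ‖κ y‖ₑ ≤ K) {f : E → ℝ}
    (hf : Measurable f) (t : ℝ) (x : E) :
    ‖T κ f t x‖ₑ ≤ K * ∫⁻ y in ball (0:E) 1, ‖f (x - t • y)‖ₑ := by
  rw [← lintegral_const_mul _ (by fun_prop)]
  refine (enorm_integral_le_lintegral_enorm _).trans ?_
  rw [← lintegral_indicator measurableSet_ball]
  refine lintegral_mono fun y => ?_
  by_cases hy : y ∈ ball (0:E) 1
  · simp only [Set.indicator_of_mem hy, enorm_mul]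
    gcongr; exact hK y
  · have : κ y = 0 := hκ.zero (by simpa using hy)
    simp [this]

/-- volume of unit ball -/
noncomputable def vB (n : ℕ) : NNReal := (volume (ball (0:EuclideanSpace ℝ (Fin n)) 1)).toNNReal

lemma vB_eq : (vB n : ENNReal) = volume (ball (0:E) 1) :=
  ENNReal.coe_toNNReal measure_ball_lt_top.ne

lemma T_L2 {κ : E → ℝ} (hκ : Ker κ) : ∃ C : NNReal, ∀ (f : E → ℝ), Measurable f → ∀ (R : ℝ)
    (M : ENNReal), (∀ z, L2 f z R ≤ M) → ∀ t z, L2 (T κ f t) z R ≤ C * M := by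
  obtain ⟨K, hK⟩ := hκ.bound
  refine ⟨K ^ 2 * vB n ^ 2, fun f hf R M hM t z => ?_⟩
  have := conv_L2 (volume.restrict (ball (0:E) 1)) (a := fun y => t • y) (by fun_prop) hf hM
    (fun x => T_enorm hκ hK hf t x) z
  simpa [vB_eq] using this

lemma IT_L2 {κ : E → ℝ} (hκ : Ker κ) : ∃ C : NNReal, ∀ (f : E → ℝ), Measurable f → ∀ (R : ℝ)
    (M : ENNReal), (∀ z, L2 f z R ≤ M) → ∀ r, 0 ≤ r → ∀ z,
    L2 (fun x => ∫ t in (0:ℝ)..r, T κ f t x) z R ≤ C * ENNReal.ofReal r ^ 2 * M := by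
  obtain ⟨K, hK⟩ := hκ.bound
  refine ⟨K ^ 2 * vB n ^ 2, fun f hf R M hM r hr z => ?_⟩
  have := conv_L2 ((volume.restrict (Set.Ioc (0:ℝ) r)).prod (volume.restrict (ball (0:E) 1)))
    (a := fun p => p.1 • p.2) (by fun_prop) hf hM
    (g := fun x => ∫ t in (0:ℝ)..r, T κ f t x) (K := K)
    (fun x => by
      rw [intervalIntegral.integral_of_le hr]
      refine (enorm_integral_le_lintegral_enorm _).trans ?_
      rw [lintegral_prod _ (by fun_prop), ← lintegral_const_mul]
      · exact lintegral_mono fun t => T_enorm hκ hK hf t x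
      · refine Measurable.lintegral_prod_right' (f := fun p : ℝ × E => ‖f (x - p.1 • p.2)‖ₑ) ?_
        fun_prop) z
  refine this.trans (le_of_eq ?_)
  rw [← Set.univ_prod_univ, Measure.prod_prod]
  simp [vB_eq]
  ring

lemma T_pt {κ : E → ℝ} (hκ : Ker κ) : ∃ C : ℝ, 0 ≤ C ∧ ∀ (f : E → ℝ), Measurable f →
    ∀ t > 0, ∀ x B, 0 ≤ B → L2 f x t ≤ ENNReal.ofReal (B ^ 2) →
      |T κ f t x| ≤ C * (B * t ^ (-(n:ℝ)/2)) := by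
  obtain ⟨K, hK⟩ := hκ.bound
  refine ⟨K * Real.sqrt (vB n), by positivity, fun f hf t ht x B hB hL => ?_⟩
  have hcv : ∫⁻ y in ball (0:E) 1, ‖f (x - t • y)‖ₑ ^ 2 = ENNReal.ofReal ((t ^ n)⁻¹) * L2 f x t := by
    have h1 : L2 f x t = ∫⁻ y in ball (0:E) t, ‖f (x - y)‖ₑ ^ 2 := by
      unfold L2
      have h := (Measure.measurePreserving_sub_left (volume : Measure E) x).setLIntegral_comp_preimage_emb
        (MeasurableEquiv.subLeft x).measurableEmbedding (fun x => ‖f x‖ₑ ^ 2) (ball x t)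
      rw [← h]
      congr 2
      ext y; simp [dist_eq_norm]
    rw [h1, ← lintegral_indicator measurableSet_ball, ← lintegral_indicator measurableSet_ball]
    have h3 : Measure.map (fun y : E => t • y) volume = ENNReal.ofReal ((t ^ n)⁻¹) • volume := by
      have := Measure.map_addHaar_smul (volume : Measure E) ht.ne'
      rw [this]
      congr 2
      rw [abs_of_nonneg (by positivity)]; simp
    rw [← smul_eq_mul, ← lintegral_smul_measure, ← h3, lintegral_map]
    · congr 1; funext y
      by_cases hy : ‖y‖ < 1
      · have : ‖t • y‖ < t := by rw [norm_smul, Real.norm_of_nonneg ht.le]; nlinarith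
        rw [Set.indicator_of_mem (by simpa using hy), Set.indicator_of_mem (by simpa using this)]
      · have : ¬ ‖t • y‖ < t := by
          rw [norm_smul, Real.norm_of_nonneg ht.le]; push Not at hy ⊢; nlinarith
        rw [Set.indicator_of_notMem (by simpa using hy),
          Set.indicator_of_notMem (by simpa using this)]
    · exact Measurable.indicator (by fun_prop) measurableSet_ball
    · fun_prop
  have h1 := T_enorm hκ hK hf t x
  have h2 : ‖T κ f t x‖ₑ ^ 2 ≤ ENNReal.ofReal (K ^ 2 * vB n * ((t ^ n)⁻¹ * B ^ 2)) := by
    refine (pow_le_pow_left' h1 2).trans ?_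
    rw [mul_pow]
    calc _ ≤ (K:ENNReal) ^ 2 * (vB n * (ENNReal.ofReal ((t ^ n)⁻¹) * ENNReal.ofReal (B ^ 2))) := by
          gcongr
          refine (cs _ (by fun_prop)).trans ?_
          rw [hcv, Measure.restrict_apply_univ, ← vB_eq]
          gcongr
      _ = _ := by
          rw [ENNReal.ofReal_mul (by positivity), ENNReal.ofReal_mul (by positivity),
            ENNReal.ofReal_mul (by positivity), ENNReal.ofReal_pow (by positivity)]
          simp [ENNReal.ofReal_coe_nnreal]; ring
  rw [← ofReal_norm, ← ENNReal.ofReal_pow (norm_nonneg _),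
    ENNReal.ofReal_le_ofReal_iff (by positivity)] at h2
  rw [Real.norm_eq_abs] at h2
  refine abs_le_of_sq_le_sq' ?_ (by positivity) |>.2
  refine h2.trans (le_of_eq ?_)
  have h3 : (t ^ (-(n:ℝ)/2)) ^ 2 = (t ^ n)⁻¹ := by
    rw [← Real.rpow_natCast, ← Real.rpow_mul ht.le]
    push_cast
    rw [div_mul_cancel₀ _ two_ne_zero, Real.rpow_neg ht.le, Real.rpow_natCast]
  rw [mul_pow, mul_pow, mul_pow, h3, Real.sq_sqrt (by positivity)]; ring

lemma L2_mono_radius {f : E → ℝ} {z : E} {r s : ℝ} (h : r ≤ s) : L2 f z r ≤ L2 f z s :=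
  lintegral_mono_set (ball_subset_ball h)

lemma sq_sum_le {ι : Type*} (S : Finset ι) (a : ι → ENNReal) :
    (∑ i ∈ S, a i) ^ 2 ≤ S.card * ∑ i ∈ S, a i ^ 2 := by
  have := ENNReal.rpow_sum_le_const_mul_sum_rpow S a (p := 2) (by norm_num)
  norm_num at this
  exact_mod_cast this

lemma L2_sum {ι : Type*} (S : Finset ι) {f : ι → E → ℝ} (hf : ∀ i, Measurable (f i)) {g : E → ℝ}
    (hg : ∀ x, g x = ∑ i ∈ S, f i x) (z : E) (r : ℝ) :
    L2 g z r ≤ S.card * ∑ i ∈ S, L2 (f i) z r := by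
  unfold L2
  rw [← lintegral_finsetSum _ (fun i _ => by have := hf i; fun_prop), ← lintegral_const_mul]
  · refine lintegral_mono fun x => ?_
    rw [hg]
    refine (pow_le_pow_left' (enorm_sum_le _ _) 2).trans (sq_sum_le _ _)
  · refine Finset.measurable_fun_sum _ fun i _ => ?_
    have := hf i; fun_prop

lemma L2_add {f g h : E → ℝ} (hf : Measurable f) (hg : Measurable g)
    (hh : ∀ x, |h x| ≤ |f x| + |g x|) (z : E) (r : ℝ) :
    L2 h z r ≤ 2 * (L2 f z r + L2 g z r) := by
  unfold L2
  rw [← lintegral_add_left (by fun_prop), ← lintegral_const_mul _ (by fun_prop)]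
  refine lintegral_mono fun x => ?_
  have h1 : ‖h x‖ₑ ^ 2 = ENNReal.ofReal (h x ^ 2) := by
    rw [← ofReal_norm, ← ENNReal.ofReal_pow (norm_nonneg _), Real.norm_eq_abs, sq_abs]
  have h2 : ‖f x‖ₑ ^ 2 = ENNReal.ofReal (f x ^ 2) := by
    rw [← ofReal_norm, ← ENNReal.ofReal_pow (norm_nonneg _), Real.norm_eq_abs, sq_abs]
  have h3 : ‖g x‖ₑ ^ 2 = ENNReal.ofReal (g x ^ 2) := by
    rw [← ofReal_norm, ← ENNReal.ofReal_pow (norm_nonneg _), Real.norm_eq_abs, sq_abs]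
  rw [h1, h2, h3, ← ENNReal.ofReal_add (by positivity) (by positivity),
    show (2:ENNReal) = ENNReal.ofReal 2 by simp, ← ENNReal.ofReal_mul (by norm_num)]
  refine ENNReal.ofReal_le_ofReal ?_
  have := hh x
  rw [← sq_abs (h x), ← sq_abs (f x), ← sq_abs (g x)]
  nlinarith [abs_nonneg (h x), abs_nonneg (f x), abs_nonneg (g x), sq_nonneg (|f x| - |g x|)]

lemma L2_pt {f : E → ℝ} {c : ℝ} (hf : ∀ x, |f x| ≤ c) (z : E) {r : ℝ} (hr : 0 < r) :
    L2 f z r ≤ ENNReal.ofReal (c ^ 2 * (r ^ n * vB n)) := by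
  unfold L2
  calc _ ≤ ∫⁻ x in ball z r, ENNReal.ofReal (c ^ 2) := by
        refine lintegral_mono fun x => ?_
        rw [← ofReal_norm, ← ENNReal.ofReal_pow (norm_nonneg _)]
        refine ENNReal.ofReal_le_ofReal ?_
        exact pow_le_pow_left₀ (norm_nonneg _) (hf x) 2
    _ = _ := by
        rw [lintegral_const, Measure.restrict_apply_univ, Measure.addHaar_ball_of_pos _ _ hr,
          ENNReal.ofReal_mul (by positivity), ENNReal.ofReal_mul (by positivity),
          ENNReal.ofReal_coe_nnreal, vB_eq]
        simp



lemma ibp0 {κ f : E → ℝ} (hκ : Sm κ) (hc : HasCompactSupport κ) (hf : Sm f) (β : Fin n) :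
    ∫ x, (κ x * pd f β x + pd κ β x * f x) = 0 := by
  have h := T_ibp hκ.cont hκ.diff hc β (hκ.pd β).cont hf (-1) 0
  simp only [T, zero_sub, neg_smul, one_smul, neg_neg] at h
  have hc' : HasCompactSupport (pd κ β) := by
    refine HasCompactSupport.of_support_subset_isCompact hc.isCompact ?_
    refine Set.Subset.trans ?_ (support_fderiv_subset ℝ (f := κ))
    intro x hx h
    apply hx
    simp only [MH.pd]
    simp [h]
  rw [integral_add (int_cpt hκ.cont hc (hf.pd β).cont) (int_cpt (hκ.pd β).cont hc' hf.cont)]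
  linarith

lemma pd_mul {f g : E → ℝ} (hf : Sm f) (hg : Sm g) (β : Fin n) (x : E) :
    pd (fun z => f z * g z) β x = pd f β x * g x + f x * pd g β x := by
  simp only [pd]
  rw [fderiv_fun_mul (hf.diff x) (hg.diff x)]
  simp; ring

lemma int4 {Q S P W : E → ℝ} (hQ : Integrable Q) (hS : Integrable S) (hP : Integrable P)
    (hW : Integrable W) : ∫ x, ((1/2) * Q x + S x + (1/2) * P x + 2 * W x) =
      (1/2) * (∫ x, Q x) + (∫ x, S x) + (1/2) * (∫ x, P x) + 2 * (∫ x, W x) := by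
  have h1 := integral_add (hQ.const_mul (1/2)) hS
  have h2 := integral_add ((hQ.const_mul (1/2)).add hS) (hP.const_mul (1/2))
  have h3 := integral_add (((hQ.const_mul (1/2)).add hS).add (hP.const_mul (1/2))) (hW.const_mul 2)
  simp only [Pi.add_apply, integral_const_mul] at h1 h2 h3
  rw [h3, h2, h1]

lemma cacc_int {v : Fin n → E → ℝ} (hv : ∀ α, Sm (v α)) (hdiv : ∀ x, ∑ α, pd (v α) α x = 0)
    {η : E → ℝ} (hη : Sm η) (hc : HasCompactSupport η) :
    ∫ x, ∑ α, ∑ β, η x ^ 2 * pd (v α) β x ^ 2 ≤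
      (∑ α, ∑ β, (∫ x, η x ^ 2 * cu v α β x ^ 2)) +
        4 * ∑ α, ∑ β, ∫ x, pd η β x ^ 2 * v α x ^ 2 := by
  have hηc := hη.cont
  have hvc := fun α => (hv α).cont
  have hpc := fun α β => ((hv α).pd β).cont
  have hcc := fun α β => (cu_sm hv α β).cont
  have hηp := fun β => (hη.pd β).cont
  have hc2 : HasCompactSupport (fun x => η x ^ 2) := by
    simp_rw [sq]; exact hc.mul_right
  have hc' : ∀ β, HasCompactSupport (fun x => pd η β x ^ 2) := by
    intro β
    simp_rw [sq]
    refine HasCompactSupport.mul_right ?_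
    refine HasCompactSupport.of_support_subset_isCompact hc.isCompact ?_
    refine Set.Subset.trans ?_ (support_fderiv_subset ℝ (f := η))
    intro x hx h
    apply hx
    simp only [MH.pd]
    simp [h]
  set κ : Fin n → Fin n → E → ℝ := fun α β x => (η x * η x) * pd (v β) α x with hκ
  have hη2 : Sm (fun x => η x * η x) := ContDiff.mul hη hη
  have hκs : ∀ α β, Sm (κ α β) := fun α β => ContDiff.mul hη2 ((hv β).pd α)
  have hκc : ∀ α β, HasCompactSupport (κ α β) := fun α β => (hc.mul_right).mul_right
  have h0 : ∫ x, ∑ α, ∑ β, (κ α β x * pd (v α) β x + pd (κ α β) β x * v α x) = 0 := by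
    have hI : ∀ α β, Integrable (fun x => κ α β x * pd (v α) β x + pd (κ α β) β x * v α x) := by
      intro α β
      have e : (fun x => κ α β x * pd (v α) β x + pd (κ α β) β x * v α x) =
        pd (fun x => κ α β x * v α x) β := by
        funext x; rw [pd_mul (hκs α β) (hv α)]; ring
      rw [e]
      have hs : Sm (fun x => κ α β x * v α x) := ContDiff.mul (hκs α β) (hv α)
      refine (hs.pd β).cont.integrable_of_hasCompactSupport ?_
      have hcc : HasCompactSupport (fun x => κ α β x * v α x) := (hκc α β).mul_right
      refine HasCompactSupport.of_support_subset_isCompact hcc.isCompact ?_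
      refine Set.Subset.trans ?_ (support_fderiv_subset ℝ (f := (fun x => κ α β x * v α x)))
      intro x hx h
      apply hx
      simp only [MH.pd]
      simp [h]
    rw [integral_finsetSum _ (fun α _ => integrable_finsetSum _ fun β _ => hI α β)]
    refine Finset.sum_eq_zero fun α _ => ?_
    rw [integral_finsetSum _ (fun β _ => hI α β)]
    exact Finset.sum_eq_zero fun β _ => ibp0 (hκs α β) (hκc α β) (hv α) β
  have hpt : ∀ x, ∑ α, ∑ β, (κ α β x * pd (v α) β x + pd (κ α β) β x * v α x) =
      ∑ α, ∑ β, (η x ^ 2 * (pd (v α) β x * pd (v β) α x) +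
        2 * η x * pd η β x * pd (v β) α x * v α x) := by
    intro x
    refine Finset.sum_congr rfl fun α _ => ?_
    have : ∀ β, κ α β x * pd (v α) β x + pd (κ α β) β x * v α x =
      (η x ^ 2 * (pd (v α) β x * pd (v β) α x) +
        2 * η x * pd η β x * pd (v β) α x * v α x) + η x ^ 2 * v α x * pd (pd (v β) α) β x := by
      intro β
      simp only [hκ]
      rw [pd_mul hη2 ((hv β).pd α), pd_mul hη hη]; ring
    simp_rw [this]
    rw [Finset.sum_add_distrib, ← Finset.mul_sum, div_pd hv hdiv]; simp
  simp_rw [hpt] at h0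
  set P : E → ℝ := fun x => ∑ α, ∑ β, η x ^ 2 * pd (v α) β x ^ 2 with hP
  have iP : Integrable P := integrable_finsetSum _ fun α _ => integrable_finsetSum _ fun β _ =>
    int_cpt (by fun_prop) hc2 (by have := hpc α β; fun_prop)
  have iQ : ∀ α β, Integrable (fun x => η x ^ 2 * cu v α β x ^ 2) := fun α β =>
    int_cpt (by fun_prop) hc2 (by have := hcc α β; fun_prop)
  have iW : ∀ α β, Integrable (fun x => pd η β x ^ 2 * v α x ^ 2) := fun α β =>
    int_cpt (by have := hηp β; fun_prop) (hc' β) (by have := hvc α; fun_prop)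
  have iQ' : Integrable (fun x => ∑ α, ∑ β, η x ^ 2 * cu v α β x ^ 2) :=
    integrable_finsetSum _ fun α _ => integrable_finsetSum _ fun β _ => iQ α β
  have iW' : Integrable (fun x => ∑ α, ∑ β, pd η β x ^ 2 * v α x ^ 2) :=
    integrable_finsetSum _ fun α _ => integrable_finsetSum _ fun β _ => iW α β
  have iS : Integrable (fun x => ∑ α, ∑ β, (η x ^ 2 * (pd (v α) β x * pd (v β) α x) +
        2 * η x * pd η β x * pd (v β) α x * v α x)) := by
    refine integrable_finsetSum _ fun α _ => integrable_finsetSum _ fun β _ => Integrable.add ?_ ?_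
    · exact int_cpt (by fun_prop) hc2 (by have := hpc α β; have := hpc β α; fun_prop)
    · have : Integrable (fun x => η x * (2 * pd η β x * pd (v β) α x * v α x)) :=
        int_cpt hηc hc (by have := hvc α; have := hpc β α; have := hηp β; fun_prop)
      refine this.congr (Filter.Eventually.of_forall fun x => ?_)
      simp only; ring
  have key : ∫ x, P x ≤ ∫ x, ((1/2) * (∑ α, ∑ β, η x ^ 2 * cu v α β x ^ 2) +
      (∑ α, ∑ β, (η x ^ 2 * (pd (v α) β x * pd (v β) α x) +
        2 * η x * pd η β x * pd (v β) α x * v α x)) + (1/2) * P x +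
        2 * (∑ α, ∑ β, pd η β x ^ 2 * v α x ^ 2)) := by
    refine integral_mono iP ((((iQ'.const_mul _).add iS).add (iP.const_mul _)).add
      (iW'.const_mul _)) fun x => ?_
    have e1 : P x = (1/2) * (∑ α, ∑ β, η x ^ 2 * pd (v α) β x ^ 2) +
      (1/2) * (∑ α, ∑ β, η x ^ 2 * pd (v β) α x ^ 2) := by
      have : (∑ α, ∑ β, η x ^ 2 * pd (v β) α x ^ 2) = P x := by
        rw [Finset.sum_comm]
      rw [this]; simp only [hP]; ring
    have e2 : P x = ∑ α, ∑ β, η x ^ 2 * pd (v β) α x ^ 2 := by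
      simp only [hP]; rw [Finset.sum_comm]
    simp only
    conv_rhs => rw [e2]
    rw [e1]
    simp only [Finset.mul_sum, ← Finset.sum_add_distrib]
    refine Finset.sum_le_sum fun α _ => Finset.sum_le_sum fun β _ => ?_
    simp only [cu]
    nlinarith [sq_nonneg (η x * pd (v β) α x + 2 * pd η β x * v α x)]
  rw [int4 iQ' iS iP iW', h0] at key
  rw [integral_finsetSum _ (fun α _ => integrable_finsetSum _ fun β _ => iQ α β),
    integral_finsetSum _ (fun α _ => integrable_finsetSum _ fun β _ => iW α β)] at key
  have eQ : ∀ α, ∫ x, ∑ β, η x ^ 2 * cu v α β x ^ 2 = ∑ β, ∫ x, η x ^ 2 * cu v α β x ^ 2 :=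
    fun α => integral_finsetSum _ (fun β _ => iQ α β)
  have eW : ∀ α, ∫ x, ∑ β, pd η β x ^ 2 * v α x ^ 2 = ∑ β, ∫ x, pd η β x ^ 2 * v α x ^ 2 :=
    fun α => integral_finsetSum _ (fun β _ => iW α β)
  simp_rw [eQ, eW] at key
  linarith

lemma enorm_sq (a : ℝ) : ‖a‖ₑ ^ 2 = ENNReal.ofReal (a ^ 2) := by
  rw [← ofReal_norm, ← ENNReal.ofReal_pow (norm_nonneg _), Real.norm_eq_abs, sq_abs]

lemma int_le_of_L2 {f w : E → ℝ} (hf : Continuous f) (hw : Continuous w) {z : E} {r c M : ℝ}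
    (hc : 0 ≤ c) (hM : 0 ≤ M) (hw0 : ∀ x, 0 ≤ w x) (hwc : ∀ x, w x ≤ c)
    (hws : ∀ x, x ∉ ball z r → w x = 0) (h : L2 f z r ≤ ENNReal.ofReal M) :
    ∫ x, w x * f x ^ 2 ≤ c * M := by
  rw [integral_eq_lintegral_of_nonneg_ae
    (Filter.Eventually.of_forall fun x => mul_nonneg (hw0 x) (sq_nonneg _))
    (Continuous.aestronglyMeasurable (by fun_prop))]
  refine ENNReal.toReal_le_of_le_ofReal (by positivity) ?_
  calc _ ≤ ∫⁻ x in ball z r, ENNReal.ofReal c * ‖f x‖ₑ ^ 2 := by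
        rw [← lintegral_indicator measurableSet_ball]
        refine lintegral_mono fun x => ?_
        by_cases hx : x ∈ ball z r
        · rw [Set.indicator_of_mem hx, enorm_sq, ← ENNReal.ofReal_mul hc]
          refine ENNReal.ofReal_le_ofReal ?_
          have := hwc x; gcongr
        · simp [hws x hx]
    _ ≤ _ := by
        rw [lintegral_const_mul _ (by have := hf.measurable; fun_prop), ENNReal.ofReal_mul hc]
        gcongr; exact h

lemma cacc : ∃ C : ℝ, 0 ≤ C ∧ ∀ (v : Fin n → E → ℝ), (∀ α, Sm (v α)) →
    (∀ x, ∑ α, pd (v α) α x = 0) → ∀ (z : E) (r M : ℝ), 0 < r → 0 ≤ M →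
    (∀ α β, L2 (cu v α β) z (2 * r) ≤ ENNReal.ofReal M) →
    (∀ α, L2 (v α) z (2 * r) ≤ ENNReal.ofReal (M * r ^ 2)) →
    ∀ α β, L2 (pd (v α) β) z r ≤ ENNReal.ofReal (C * M) := by
  let b : ContDiffBump (0 : E) := ⟨1, 2, one_pos, one_lt_two⟩
  have hb : Sm (b : E → ℝ) := b.contDiff
  have hbb : ∀ β, ∃ K, ∀ x, ‖pd (b : E → ℝ) β x‖ ≤ K := by
    intro β
    refine HasCompactSupport.exists_bound_of_continuous ?_ (hb.pd β).cont
    refine HasCompactSupport.of_support_subset_isCompact b.hasCompactSupport.isCompact ?_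
    refine Set.Subset.trans ?_ (support_fderiv_subset ℝ (f := b))
    intro x hx h
    apply hx
    simp only [MH.pd]
    simp [h]
  choose K hK using hbb
  refine ⟨∑ α : Fin n, ∑ β : Fin n, 1 + 4 * ∑ α : Fin n, ∑ β : Fin n, K β ^ 2, by positivity,
    fun v hv hdiv z r M hr hM h1 h2 α β => ?_⟩
  set η : E → ℝ := fun x => b (r⁻¹ • (x - z)) with hη
  have hηs : Sm η := ContDiff.comp (g := (b : E → ℝ)) hb (by fun_prop)
  have hη1 : ∀ x ∈ ball z r, η x = 1 := by
    intro x hx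
    refine b.one_of_mem_closedBall ?_
    simp only [mem_closedBall, dist_zero_right, norm_smul, norm_inv, Real.norm_of_nonneg hr.le]
    rw [mem_ball_iff_norm] at hx
    change r⁻¹ * ‖x - z‖ ≤ 1
    rw [inv_mul_le_iff₀ hr]; linarith
  have hη0 : ∀ x, x ∉ ball z (2*r) → r⁻¹ • (x - z) ∉ Function.support b := by
    intro x hx h
    rw [b.support_eq] at h
    apply hx
    simp only [mem_ball, dist_zero_right, norm_smul, norm_inv, Real.norm_of_nonneg hr.le] at h
    change r⁻¹ * ‖x - z‖ < 2 at h
    rw [inv_mul_lt_iff₀ hr] at h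
    rw [mem_ball_iff_norm]; linarith
  have hηpd : ∀ x β, pd η β x = r⁻¹ * pd (b : E → ℝ) β (r⁻¹ • (x - z)) := by
    intro x β
    have h1 : HasFDerivAt (fun x : E => r⁻¹ • (x - z)) (r⁻¹ • ContinuousLinearMap.id ℝ E) x :=
      ((hasFDerivAt_id x).sub_const z).const_smul r⁻¹
    have h2 := ((hb.diff _).hasFDerivAt.comp x h1).fderiv
    have : fderiv ℝ η x = _ := h2
    simp only [pd, this]
    simp
  have hcs : HasCompactSupport η := by
    refine HasCompactSupport.of_support_subset_isCompact (isCompact_closedBall z (2*r)) ?_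
    intro x hx
    by_contra hcon
    exact hη0 x (fun h => hcon (ball_subset_closedBall h)) hx
  have hmain := cacc_int hv hdiv hηs hcs
  have hηc := hηs.cont
  have hle1 : ∀ x, η x ^ 2 ≤ 1 := fun x => by
    have h0 : 0 ≤ η x := b.nonneg
    have h1 : η x ≤ 1 := b.le_one
    nlinarith
  have hz1 : ∀ x, x ∉ ball z (2*r) → η x ^ 2 = 0 := fun x hx => by
    have := hη0 x hx
    simp only [Function.mem_support, not_not] at this
    simp [hη, this]
  have hz2 : ∀ β x, x ∉ ball z (2*r) → pd η β x ^ 2 = 0 := by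
    intro β x hx
    have hx2 : x ∉ ball z (2*r) := hx
    have hsm : ∀ y, 0 ≤ η y := fun y => b.nonneg
    have hmin : IsLocalMin η x := by
      refine Filter.Eventually.of_forall fun y => ?_
      have := hz1 x hx
      have h0 : η x = 0 := by simpa using this
      rw [h0]; exact hsm y
    simp [pd, hmin.fderiv_eq_zero]
  have hrhs : (∑ α, ∑ β, (∫ x, η x ^ 2 * cu v α β x ^ 2)) +
      4 * ∑ α, ∑ β, ∫ x, pd η β x ^ 2 * v α x ^ 2 ≤
      (∑ α : Fin n, ∑ β : Fin n, 1 + 4 * ∑ α : Fin n, ∑ β : Fin n, K β ^ 2) * M := by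
    rw [add_mul, mul_assoc, Finset.sum_mul, Finset.sum_mul]
    simp_rw [Finset.sum_mul]
    refine add_le_add (Finset.sum_le_sum fun a _ => Finset.sum_le_sum fun b' _ => ?_)
      (mul_le_mul_of_nonneg_left (Finset.sum_le_sum fun a _ => Finset.sum_le_sum fun b' _ => ?_)
        (by norm_num))
    · exact int_le_of_L2 (cu_sm hv a b').cont (by fun_prop) zero_le_one hM (fun x => sq_nonneg _)
        hle1 hz1 (h1 a b')
    · have hle2 : ∀ x, pd η b' x ^ 2 ≤ (r⁻¹) ^ 2 * K b' ^ 2 := by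
        intro x
        rw [hηpd, mul_pow]
        have := hK b' (r⁻¹ • (x - z))
        rw [Real.norm_eq_abs] at this
        refine mul_le_mul_of_nonneg_left ?_ (sq_nonneg _)
        exact sq_le_sq' (abs_le.1 this).1 (abs_le.1 this).2
      have hpc := (hηs.pd b').cont
      have := int_le_of_L2 (hv a).cont (w := fun x => pd η b' x ^ 2) (by fun_prop)
        (c := (r⁻¹) ^ 2 * K b' ^ 2) (by positivity) (by positivity) (fun x => sq_nonneg _)
        hle2 (hz2 b') (h2 a)
      refine this.trans (le_of_eq ?_)
      field_simp
  refine le_trans ?_ (ENNReal.ofReal_le_ofReal (hmain.trans hrhs))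
  rw [ofReal_integral_eq_lintegral_ofReal]
  · unfold L2
    rw [← lintegral_indicator measurableSet_ball]
    refine lintegral_mono fun x => ?_
    by_cases hx : x ∈ ball z r
    · rw [Set.indicator_of_mem hx, enorm_sq]
      refine ENNReal.ofReal_le_ofReal ?_
      simp only [hη1 x hx, one_pow, one_mul]
      refine le_trans ?_ (Finset.single_le_sum (f := fun α => ∑ β, pd (v α) β x ^ 2)
        (fun i _ => by positivity) (Finset.mem_univ α))
      exact Finset.single_le_sum (f := fun β => pd (v α) β x ^ 2)
        (fun i _ => by positivity) (Finset.mem_univ β)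
    · rw [Set.indicator_of_notMem hx]; exact zero_le
  · refine integrable_finsetSum _ fun α _ => integrable_finsetSum _ fun β _ => ?_
    have := ((hv α).pd β).cont
    refine int_cpt (by fun_prop) ?_ (by fun_prop)
    simp_rw [sq]; exact hcs.mul_right
  · exact Filter.Eventually.of_forall fun x => by positivity



lemma T_meas {κ f : E → ℝ} (hκ : Measurable κ) (hf : Measurable f) :
    StronglyMeasurable (fun p : E × ℝ => T κ f p.2 p.1) := by
  unfold T
  have : StronglyMeasurable (fun p : (E × ℝ) × E => κ p.2 * f (p.1.1 - p.1.2 • p.2)) :=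
    Measurable.stronglyMeasurable (by fun_prop)
  exact this.integral_prod_right'

lemma IT_meas {κ f : E → ℝ} (hκ : Measurable κ) (hf : Measurable f) {a b : ℝ} (hab : a ≤ b) :
    Measurable (fun x : E => ∫ t in a..b, T κ f t x) := by
  simp_rw [intervalIntegral.integral_of_le hab]
  exact ((T_meas hκ hf).integral_prod_right' (ν := volume.restrict (Set.Ioc a b))).measurable

lemma cu_pd {u : Fin n → E → ℝ} (hu : ∀ α, Sm (u α)) (γ α β : Fin n) :
    cu (fun α => pd (u α) γ) α β = pd (cu u α β) γ := by
  funext x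
  have h : pd (cu u α β) γ x = _ := pd_sub ((hu α).pd β) ((hu β).pd α) γ x
  rw [h, pd_comm (hu α), pd_comm (hu β)]
  rfl

lemma near {ρ Ψ : E → ℝ} (hρ : Ker ρ) (hΨ : Sm Ψ) (hΨc : HasCompactSupport Ψ)
    (hpd : ∀ β y, pd Ψ β y = -(ρ y * y β)) (h1 : ∫ y, ρ y = 1) :
    ∃ C : ℝ, 0 ≤ C ∧ ∀ u : Fin n → E → ℝ, (∀ α, Sm (u α)) → (∀ x, ∑ α, pd (u α) α x = 0) →
    ∀ r M : ℝ, 0 < r → 0 ≤ M → (∀ α β z, L2 (cu u α β) z (2 * r) ≤ ENNReal.ofReal M) →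
    ∀ α β z, L2 (fun x => u α x - T ρ (u α) r x) z r ≤ ENNReal.ofReal (C * M * r ^ 2) ∧
      L2 (fun x => pd (u α) β x - T ρ (pd (u α) β) r x) z r ≤ ENNReal.ofReal (C * M) := by
  choose K hK using fun β => IT_L2 (hρ.mulc β)
  obtain ⟨K0, hK0⟩ := T_L2 hρ
  obtain ⟨K1, hK1, hc⟩ := cacc (n := n)
  set Ka : ℝ := n * ∑ β, (K β : ℝ) with hKa
  set Kb : ℝ := 2 * (1 + K0) with hKb
  have hKa0 : 0 ≤ Ka := by positivity
  have hKb0 : 0 ≤ Kb := by positivity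
  refine ⟨Ka + K1 * (Ka + Kb), by positivity, fun u hu hdiv r M hr hM hM1 => ?_⟩
  set v : Fin n → E → ℝ := fun α x => u α x - T ρ (u α) r x with hv
  have hTs : ∀ α, Sm (T ρ (u α) r) := fun α => T_smooth hρ hr.ne' (hu α).cont
  have hvs : ∀ α, Sm (v α) := fun α => (hu α).sub (hTs α)
  have hpv : ∀ α β x, pd (v α) β x = pd (u α) β x - T ρ (pd (u α) β) r x := by
    intro α β x
    rw [← pd_T hρ hr.ne' (hu α), ← pd_sub (hu α) (hTs α)]
  have hvL : ∀ α z, L2 (v α) z (2 * r) ≤ ENNReal.ofReal (Ka * M * r ^ 2) := by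
    intro α z
    refine (L2_sum Finset.univ
      (f := fun β x => ∫ t in (0:ℝ)..r, T (fun y => ρ y * y β) (cu u α β) t x)
      (fun β => IT_meas (hρ.mulc β).1.cont.measurable (cu_sm hu α β).cont.measurable hr.le)
      (g := v α) (fun x => ?_) z (2 * r)).trans ?_
    · rw [← ftc hρ hΨ hΨc hpd hu hdiv, T_zero h1]
    · have : ∀ β, L2 (fun x => ∫ t in (0:ℝ)..r, T (fun y => ρ y * y β) (cu u α β) t x) z (2 * r) ≤
          ENNReal.ofReal (K β * r ^ 2 * M) := by
        intro β
        refine (hK β _ (cu_sm hu α β).cont.measurable (2*r) _ (hM1 α β) r hr.le z).trans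
          (le_of_eq ?_)
        rw [ENNReal.ofReal_mul (by positivity), ENNReal.ofReal_mul (by positivity),
          ENNReal.ofReal_pow hr.le]; simp
      refine (mul_le_mul_right (Finset.sum_le_sum fun β _ => this β) _).trans ?_
      rw [← ENNReal.ofReal_sum_of_nonneg (fun β _ => by positivity), ← ENNReal.ofReal_natCast,
        ← ENNReal.ofReal_mul (by positivity)]
      refine ENNReal.ofReal_le_ofReal (le_of_eq ?_)
      rw [hKa, Finset.card_univ, Fintype.card_fin, ← Finset.sum_mul, ← Finset.sum_mul]; ring
  have hcv : ∀ α β z, L2 (cu v α β) z (2 * r) ≤ ENNReal.ofReal (Kb * M) := by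
    intro α β z
    have e : ∀ x, cu v α β x = cu u α β x - T ρ (cu u α β) r x := by
      intro x
      have : T ρ (cu u α β) r x = T ρ (pd (u α) β) r x - T ρ (pd (u β) α) r x :=
        T_sub hρ.1.cont hρ.cpt ((hu α).pd β).cont ((hu β).pd α).cont r x
      simp only [cu, hpv] at this ⊢
      rw [this]; ring
    refine (L2_add (cu_sm hu α β).cont.measurable
      (T_smooth hρ hr.ne' (cu_sm hu α β).cont).cont.measurable
      (fun x => by rw [e]; exact abs_sub _ _) z (2*r)).trans ?_
    refine (mul_le_mul_right (add_le_add (hM1 α β z)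
      (hK0 _ (cu_sm hu α β).cont.measurable (2*r) _ (hM1 α β) r z)) _).trans (le_of_eq ?_)
    rw [hKb, ENNReal.ofReal_mul (by positivity), ENNReal.ofReal_mul (by positivity),
      ENNReal.ofReal_add (by positivity) (by positivity)]
    simp; ring
  have hdv : ∀ x, ∑ α, pd (v α) α x = 0 := by
    intro x
    simp_rw [hpv]
    rw [Finset.sum_sub_distrib, hdiv, ← T_sum _ hρ.1.cont hρ.cpt (fun α => ((hu α).pd α).cont)]
    simp_rw [hdiv]
    simp [T]
  intro α β z
  constructor
  · refine (L2_mono_radius (by linarith)).trans ((hvL α z).trans (ENNReal.ofReal_le_ofReal ?_))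
    have : 0 ≤ K1 * (Ka + Kb) := by positivity
    gcongr; linarith
  · have := hc v hvs hdv z r ((Ka + Kb) * M) hr (by positivity)
      (fun α β => (hcv α β z).trans (ENNReal.ofReal_le_ofReal (by gcongr; linarith)))
      (fun α => (hvL α z).trans (ENNReal.ofReal_le_ofReal (by gcongr; linarith))) α β
    have e : pd (v α) β = fun x => pd (u α) β x - T ρ (pd (u α) β) r x := funext (hpv α β)
    rw [e] at this
    refine this.trans (ENNReal.ofReal_le_ofReal ?_)
    rw [← mul_assoc]; gcongr; linarith

lemma T_pt' {lam : ℝ} {κ : E → ℝ} (hκ : Ker κ) : ∃ C : ℝ, 0 ≤ C ∧ ∀ (f : E → ℝ), Measurable f →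
    ∀ A, 0 ≤ A → (∀ z r, 0 < r → r ≤ 1 → L2 f z r ≤ ENNReal.ofReal (A ^ 2 * r ^ lam)) →
    ∀ t x, 0 < t → t ≤ 1 → |T κ f t x| ≤ C * A * t ^ (-((n - lam) / 2)) := by
  obtain ⟨C, hC, h⟩ := T_pt hκ
  refine ⟨C, hC, fun f hf A hA hL t x ht ht1 => ?_⟩
  refine (h f hf t ht x (A * t ^ (lam/2)) (by positivity) ?_).trans (le_of_eq ?_)
  · refine (hL x t ht ht1).trans (le_of_eq ?_)
    rw [mul_pow, ← Real.rpow_natCast (t ^ (lam/2)), ← Real.rpow_mul ht.le]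
    congr 3; push_cast; ring
  · rw [mul_assoc A, ← Real.rpow_add ht, mul_assoc]
    congr 3; ring

lemma int_far {g : ℝ → ℝ} {K μ r : ℝ} (hK : 0 ≤ K) (hμ : 0 < μ) (hr : 0 < r) (hr1 : r ≤ 1)
    (h : ∀ t, 0 < t → t ≤ 1 → |g t| ≤ K * t ^ (-μ - 1)) :
    |∫ t in r..1, g t| ≤ K / μ * r ^ (-μ) := by
  have hnot : (0:ℝ) ∉ Set.uIcc r 1 := by
    rw [Set.uIcc_of_le hr1]; intro h; linarith [h.1]
  have := intervalIntegral.norm_integral_le_of_norm_le hr1 (f := g) (g := fun t => K * t ^ (-μ - 1))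
    (μ := volume) (Filter.Eventually.of_forall fun t ht => h t (hr.trans ht.1) ht.2)
    ((intervalIntegral.intervalIntegrable_rpow (Or.inr hnot)).const_mul K)
  rw [Real.norm_eq_abs] at this
  refine this.trans ?_
  rw [intervalIntegral.integral_const_mul, integral_rpow (Or.inr ⟨by linarith, hnot⟩)]
  simp only [Real.one_rpow, sub_add_cancel]
  rw [div_mul_eq_mul_div, mul_div_assoc]
  refine mul_le_mul_of_nonneg_left ?_ hK
  rw [div_neg, ← neg_div]
  gcongr; linarith

lemma far {ρ Ψ : E → ℝ} (hρ : Ker ρ) (hΨ : Sm Ψ) (hΨc : HasCompactSupport Ψ)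
    (hpd : ∀ β y, pd Ψ β y = -(ρ y * y β)) {lam : ℝ} (hl : lam < n) :
    ∃ C : ℝ, 0 ≤ C ∧ ∀ u : Fin n → E → ℝ, (∀ α, Sm (u α)) → (∀ x, ∑ α, pd (u α) α x = 0) →
    ∀ A, 0 ≤ A → (∀ α β z r, 0 < r → r ≤ 1 → L2 (cu u α β) z r ≤ ENNReal.ofReal (A^2 * r^lam)) →
    (∀ α z, L2 (u α) z 1 ≤ ENNReal.ofReal (A ^ 2)) → ∀ r, 0 < r → r ≤ 1 → ∀ α γ x,
    |T ρ (u α) r x| ≤ C * A * r ^ (-((n - lam) / 2)) ∧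
    |T ρ (pd (u α) γ) r x| ≤ C * A * r ^ (-((n - lam) / 2)) := by
  obtain ⟨C0, hC0, h0⟩ := T_pt hρ
  choose C1 hC1 h1 using fun γ => T_pt (hρ.pd γ)
  choose C2 hC2 h2 using fun β => T_pt' (lam := lam) (hρ.mulc β)
  choose C3 hC3 h3 using fun β γ => T_pt' (lam := lam) ((hρ.mulc β).pd γ)
  set μ : ℝ := (n - lam) / 2 with hμ
  have hμ0 : 0 < μ := by rw [hμ]; linarith
  refine ⟨C0 + ∑ γ, C1 γ + ∑ β, C2 β / μ + ∑ β, ∑ γ, C3 β γ / μ, by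
    have := fun γ => hC1 γ
    have := fun γ => hC2 γ
    have := fun β γ => hC3 β γ
    have a1 := Finset.sum_nonneg (fun γ (_ : γ ∈ Finset.univ) => hC1 γ)
    have a2 := Finset.sum_nonneg (fun γ (_ : γ ∈ Finset.univ) => div_nonneg (hC2 γ) hμ0.le)
    have a3 := Finset.sum_nonneg (fun β (_ : β ∈ Finset.univ) =>
      Finset.sum_nonneg (fun γ (_ : γ ∈ Finset.univ) => div_nonneg (hC3 β γ) hμ0.le))
    linarith, ?_⟩
  intro u hu hdiv A hA hcu hu1 r hr hr1 α γ x
  have a1 := Finset.sum_nonneg (fun γ (_ : γ ∈ Finset.univ) => hC1 γ)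
  have a2 := Finset.sum_nonneg (fun γ (_ : γ ∈ Finset.univ) => div_nonneg (hC2 γ) hμ0.le)
  have a3 := Finset.sum_nonneg (fun β (_ : β ∈ Finset.univ) =>
      Finset.sum_nonneg (fun γ (_ : γ ∈ Finset.univ) => div_nonneg (hC3 β γ) hμ0.le))
  have hrμ : 1 ≤ r ^ (-μ) := Real.one_le_rpow_of_pos_of_le_one_of_nonpos hr hr1 (by linarith)
  have hAr : A ≤ A * r ^ (-μ) := le_mul_of_one_le_right hA hrμ
  have hAr0 : 0 ≤ A * r ^ (-μ) := hA.trans hAr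
  have hmc := fun α β => (cu_sm hu α β).cont.measurable
  constructor
  · have hf := ftc hρ hΨ hΨc hpd hu hdiv α x r 1
    have b1 : |T ρ (u α) 1 x| ≤ C0 * (A * r ^ (-μ)) := by
      have := h0 (u α) (hu α).cont.measurable 1 one_pos x A hA (hu1 α x)
      simp only [Real.one_rpow, mul_one] at this
      exact this.trans (by gcongr)
    have b2 : |∑ β, ∫ t in r..1, T (fun y => ρ y * y β) (cu u α β) t x| ≤
        (∑ β, C2 β / μ) * (A * r ^ (-μ)) := by
      refine (Finset.abs_sum_le_sum_abs _ _).trans ?_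
      rw [Finset.sum_mul]
      refine Finset.sum_le_sum fun β _ => ?_
      refine (int_far (K := C2 β * A) (μ := μ) (mul_nonneg (hC2 β) hA) hμ0 hr hr1
        fun t ht ht1 => ?_).trans (le_of_eq (by ring))
      refine (h2 β _ (hmc α β) A hA (hcu α β) t x ht ht1).trans ?_
      refine mul_le_mul_of_nonneg_left ?_ (mul_nonneg (hC2 β) hA)
      exact Real.rpow_le_rpow_of_exponent_ge ht ht1 (by linarith)
    have e : T ρ (u α) r x = T ρ (u α) 1 x + ∑ β, ∫ t in r..1, T (fun y => ρ y * y β) (cu u α β) t x := by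
      linarith
    rw [e]
    refine (abs_add_le _ _).trans ((add_le_add b1 b2).trans ?_)
    rw [← add_mul, mul_assoc]
    refine mul_le_mul_of_nonneg_right ?_ hAr0
    linarith
  · have hf := ftc hρ hΨ hΨc hpd (fun α => (hu α).pd γ) (div_pd hu hdiv γ) α x r 1
    have b1 : |T ρ (pd (u α) γ) 1 x| ≤ C1 γ * (A * r ^ (-μ)) := by
      have e := T_ibp hρ.1.cont hρ.1.diff hρ.cpt γ (hρ.1.pd γ).cont (hu α) 1 x
      rw [one_mul] at e
      rw [e]
      have := h1 γ (u α) (hu α).cont.measurable 1 one_pos x A hA (hu1 α x)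
      simp only [Real.one_rpow, mul_one] at this
      exact this.trans (mul_le_mul_of_nonneg_left hAr (hC1 γ))
    have b2 : |∑ β, ∫ t in r..1, T (fun y => ρ y * y β) (cu (fun α => pd (u α) γ) α β) t x| ≤
        (∑ β, C3 β γ / μ) * (A * r ^ (-μ)) := by
      refine (Finset.abs_sum_le_sum_abs _ _).trans ?_
      rw [Finset.sum_mul]
      refine Finset.sum_le_sum fun β _ => ?_
      refine (int_far (K := C3 β γ * A) (μ := μ) (mul_nonneg (hC3 β γ) hA) hμ0 hr hr1
        fun t ht ht1 => ?_).trans (le_of_eq (by ring))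
      have hk := hρ.mulc β
      have e := T_ibp hk.1.cont hk.1.diff hk.cpt γ (hk.1.pd γ).cont (cu_sm hu α β) t x
      rw [cu_pd hu]
      have e' : T (fun y => ρ y * y β) (pd (cu u α β) γ) t x =
        t⁻¹ * T (pd (fun y => ρ y * y β) γ) (cu u α β) t x := by
        rw [← e]; field_simp
      rw [e', abs_mul, abs_of_pos (inv_pos.2 ht), Real.rpow_sub_one ht.ne', mul_comm,
        ← div_eq_mul_inv, ← mul_div_assoc]
      refine div_le_div_of_nonneg_right ?_ ht.le
      exact h3 β γ _ (hmc α β) A hA (hcu α β) t x ht ht1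
    have e : T ρ (pd (u α) γ) r x = T ρ (pd (u α) γ) 1 x +
        ∑ β, ∫ t in r..1, T (fun y => ρ y * y β) (cu (fun α => pd (u α) γ) α β) t x := by
      linarith
    rw [e]
    refine (abs_add_le _ _).trans ((add_le_add b1 b2).trans ?_)
    rw [← add_mul, mul_assoc]
    refine mul_le_mul_of_nonneg_right ?_ hAr0
    have a4 : C1 γ ≤ ∑ γ, C1 γ := Finset.single_le_sum (fun i _ => hC1 i) (Finset.mem_univ γ)
    have a5 : ∑ β, C3 β γ / μ ≤ ∑ β, ∑ γ, C3 β γ / μ := Finset.sum_le_sum fun β _ =>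
      Finset.single_le_sum (f := fun γ => C3 β γ / μ)
        (fun i _ => div_nonneg (hC3 β i) hμ0.le) (Finset.mem_univ γ)
    linarith

theorem thmG (hn : 0 < n) {lam : ℝ} (hl : lam < n) :
    ∃ C : ℝ, 0 ≤ C ∧ ∀ u : Fin n → E → ℝ, (∀ α, Sm (u α)) → (∀ x, ∑ α, pd (u α) α x = 0) →
    ∀ A, 0 ≤ A → (∀ α β z r, 0 < r → r ≤ 1 → L2 (cu u α β) z r ≤ ENNReal.ofReal (A^2 * r^lam)) →
    (∀ α z, L2 (u α) z 1 ≤ ENNReal.ofReal (A ^ 2)) → ∀ r, 0 < r → r ≤ 1 / 2 → ∀ α β z,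
    L2 (pd (u α) β) z r ≤ ENNReal.ofReal (C * A ^ 2 * r ^ lam) ∧
    L2 (u α) z r ≤ ENNReal.ofReal (C * A ^ 2 * r ^ lam) := by
  obtain ⟨ρ, Ψ, hρ, hΨ, hΨc, h1, hpd⟩ := exists_kernel hn
  obtain ⟨C1, hC1, hnear⟩ := near hρ hΨ hΨc hpd h1
  obtain ⟨C2, hC2, hfar⟩ := far hρ hΨ hΨc hpd hl
  refine ⟨2 * (C1 * 2 ^ lam + C2 ^ 2 * vB n), by positivity, ?_⟩
  intro u hu hdiv A hA hcu hu1 r hr hr2 α β z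
  have hM : ∀ α β z, L2 (cu u α β) z (2 * r) ≤ ENNReal.ofReal (A ^ 2 * (2 ^ lam * r ^ lam)) := by
    intro α β z
    rw [← Real.mul_rpow (by norm_num) hr.le]
    exact hcu α β z (2*r) (by linarith) (by linarith)
  have hN := hnear u hu hdiv r _ hr (by positivity) hM α β z
  have hF := fun x => hfar u hu hdiv A hA hcu hu1 r hr (by linarith) α β x
  have hpt : (C2 * A * r ^ (-((n - lam) / 2))) ^ 2 * (r ^ n * vB n) =
      C2 ^ 2 * vB n * A ^ 2 * r ^ lam := by
    have : (r ^ (-((n - lam) / 2))) ^ 2 * r ^ n = r ^ lam := by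
      rw [← Real.rpow_natCast (r ^ (-((n - lam) / 2))), ← Real.rpow_mul hr.le, ← Real.rpow_natCast,
        ← Real.rpow_add hr]
      congr 1; push_cast; ring
    rw [← this]; ring
  have fin : ∀ f : E → ℝ, Sm f → L2 (fun x => f x - T ρ f r x) z r ≤
      ENNReal.ofReal (C1 * (A ^ 2 * (2 ^ lam * r ^ lam))) →
      (∀ x, |T ρ f r x| ≤ C2 * A * r ^ (-((n - lam) / 2))) →
      L2 f z r ≤ ENNReal.ofReal (2 * (C1 * 2 ^ lam + C2 ^ 2 * vB n) * A ^ 2 * r ^ lam) := by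
    intro f hf e1 e2
    have hT := (T_smooth hρ hr.ne' hf.cont).cont
    have hfc := hf.cont
    refine (L2_add (f := fun x => f x - T ρ f r x) (g := T ρ f r)
      (Continuous.measurable (by fun_prop)) hT.measurable
      (fun x => by
        calc |f x| = |(f x - T ρ f r x) + T ρ f r x| := by ring_nf
          _ ≤ _ := abs_add_le _ _) z r).trans ?_
    refine (mul_le_mul_right (add_le_add e1 (L2_pt e2 z hr)) _).trans (le_of_eq ?_)
    rw [hpt, ← ENNReal.ofReal_add (by positivity) (by positivity)]
    have : (2 : ENNReal) = ENNReal.ofReal 2 := by simp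
    rw [this, ← ENNReal.ofReal_mul (by norm_num)]
    congr 1; ring
  refine ⟨fin _ ((hu α).pd β) hN.2 fun x => (hF x).2, fin _ (hu α) (hN.1.trans
    (ENNReal.ofReal_le_ofReal ?_)) fun x => (hF x).1⟩
  have : r ^ 2 ≤ 1 := by nlinarith
  exact mul_le_of_le_one_right (by positivity) this



lemma Q_preimage : (WithLp.toLp 2) ⁻¹' (unitCube n) = (Set.Icc (0 : Fin n → ℝ) 1) := by
  ext x
  simp only [unitCube, Set.mem_preimage, Set.mem_ofPred_eq, Set.mem_Icc, Pi.le_def]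
  exact ⟨fun h => ⟨fun i => (h i).1, fun i => (h i).2⟩, fun h i => ⟨h.1 i, h.2 i⟩⟩

lemma Q_closed : IsClosed (unitCube n) := by
  have : unitCube n = ⋂ i, (fun x : E => x i) ⁻¹' Set.Icc 0 1 := by
    ext x; simp [unitCube]
  rw [this]
  exact isClosed_iInter fun i => isClosed_Icc.preimage (by fun_prop)

lemma Q_compact : IsCompact (unitCube n) := by
  have h : IsCompact (Set.Icc (0 : Fin n → ℝ) 1) := isCompact_Icc
  have := h.image (PiLp.continuous_toLp 2 (fun _ : Fin n => ℝ))
  rw [← Q_preimage, Set.image_preimage_eq] at this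
  · exact this
  · intro x; exact ⟨x.ofLp, rfl⟩

lemma Q_meas : MeasurableSet (unitCube n) := Q_closed.measurableSet

lemma setInt_toLp (f : E → ℝ) : ∫ x in unitCube n, f x =
    ∫ x in Set.Icc (0 : Fin n → ℝ) 1, f (WithLp.toLp 2 x) := by
  rw [← Q_preimage]
  exact ((PiLp.volume_preserving_toLp (Fin n)).setIntegral_preimage_emb
    (MeasurableEquiv.toLp 2 (Fin n → ℝ)).measurableEmbedding f (unitCube n)).symm

lemma divQ {X : Fin n → E → ℝ} (hX : ∀ β, Sm (X β))
    (h0 : ∀ x ∈ unitCube n, ∀ β, (x β = 0 ∨ x β = 1) → X β x = 0) :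
    ∫ x in unitCube n, ∑ β, pd (X β) β x = 0 := by
  rw [setInt_toLp]
  cases n with
  | zero => simp
  | succ m =>
  set L : (Fin (m+1) → ℝ) →L[ℝ] EuclideanSpace ℝ (Fin (m+1)) :=
    ((EuclideanSpace.equiv (Fin (m+1)) ℝ).symm :
      (Fin (m+1) → ℝ) →L[ℝ] EuclideanSpace ℝ (Fin (m+1))) with hL
  have hLe : ∀ x, L x = WithLp.toLp 2 x := fun x => rfl
  have hst : ∀ i, L (Pi.single i 1) = stdVec (m+1) i := fun i => rfl
  have := integral_divergence_of_hasFDerivAt_off_countable' (0 : Fin (m+1) → ℝ) 1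
    (by intro i; simp) (fun i x => X i (L x)) (fun i x => (fderiv ℝ (X i) (L x)).comp L) ∅
    Set.countable_empty (fun i => ((hX i).cont.comp L.continuous).continuousOn)
    (fun x _ i => ((hX i).diff (L x)).hasFDerivAt.comp x L.hasFDerivAt) ?_
  · simp only [ContinuousLinearMap.comp_apply, hst] at this
    simp only [pd, ← hLe]
    rw [this]
    refine Finset.sum_eq_zero fun i _ => ?_
    have e : ∀ c : ℝ, (c = 0 ∨ c = 1) → ∫ x in Set.Icc ((0 : Fin (m+1) → ℝ) ∘ i.succAbove)
        ((1 : Fin (m+1) → ℝ) ∘ i.succAbove), X i (L (i.insertNth c x)) = 0 := by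
      intro c hc
      refine setIntegral_eq_zero_of_forall_eq_zero fun x hx => ?_
      refine h0 _ ?_ i ?_
      · intro j
        rw [hLe]
        refine Fin.succAboveCases i ?_ (fun k => ?_) j
        · simp; rcases hc with rfl | rfl <;> simp
        · simp; exact ⟨hx.1 k, hx.2 k⟩
      · rw [hLe]; simpa using hc
    have e0 := e 0 (Or.inl rfl)
    have e1 := e 1 (Or.inr rfl)
    simp only [Pi.one_apply, Pi.zero_apply]
    rw [e1, e0, sub_zero]
  · refine Continuous.integrableOn_Icc ?_
    simp only [ContinuousLinearMap.comp_apply, hst]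
    refine continuous_finsetSum _ fun i _ => ?_
    exact ((hX i).pd i).cont.comp L.continuous

lemma pd_zero {f : E → ℝ} (hf : Sm f) {x : E} (hx : x ∈ unitCube n) {α : Fin n}
    (h : ∀ t ∈ Set.Icc (0:ℝ) 1, f (x + (t - x α) • stdVec n α) = 0) : pd f α x = 0 := by
  have h1 : HasDerivAt (fun t : ℝ => x + (t - x α) • stdVec n α) (stdVec n α) (x α) := by
    simpa using (((hasDerivAt_id (x α)).sub_const (x α)).smul_const (stdVec n α)).const_add x
  have h2 : HasFDerivAt f (fderiv ℝ f x) (x + (x α - x α) • stdVec n α) := by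
    simpa using (hf.diff x).hasFDerivAt
  have h3 := (h2.comp_hasDerivAt (x α) h1).hasDerivWithinAt (s := Set.Icc 0 1)
  have h4 : HasDerivWithinAt (fun _ : ℝ => (0:ℝ)) (pd f α x) (Set.Icc 0 1) (x α) :=
    h3.congr (fun t ht => (h t ht).symm) (h _ (hx α)).symm
  have := (uniqueDiffOn_Icc (zero_lt_one (α := ℝ)) _ (hx α)).eq_deriv _ h4
    (hasDerivWithinAt_const _ _ _)
  exact this

lemma shift_mem {x : E} (hx : x ∈ unitCube n) (α : Fin n) {t : ℝ} (ht : t ∈ Set.Icc (0:ℝ) 1) :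
    x + (t - x α) • stdVec n α ∈ unitCube n := by
  intro i
  by_cases h : i = α
  · subst h; simpa [stdVec] using ht
  · simpa [stdVec, h] using hx i

lemma intQ {f : E → ℝ} (hf : Continuous f) : IntegrableOn f (unitCube n) :=
  hf.continuousOn.integrableOn_compact Q_compact

lemma gaffney {u : Fin n → E → ℝ} (hu : ∀ α, Sm (u α))
    (hdiv : ∀ x ∈ unitCube n, ∑ α, pd (u α) α x = 0)
    (hbc : ∀ x ∈ unitCube n, ∀ α, (x α = 0 ∨ x α = 1) → u α x = 0) :
    ∫ x in unitCube n, ∑ α, ∑ β, pd (u α) β x ^ 2 =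
      (1/2) * ∫ x in unitCube n, ∑ α, ∑ β, cu u α β x ^ 2 := by
  have hpc := fun α β => ((hu α).pd β).cont
  have hcc := fun α β => (cu_sm hu α β).cont
  have hX : ∀ β, Sm (fun x => ∑ α, u α x * pd (u β) α x) := fun β =>
    ContDiff.sum fun α _ => ContDiff.mul (hu α) ((hu β).pd α)
  have h := divQ hX (by
    intro x hx β hb
    refine Finset.sum_eq_zero fun α _ => ?_
    by_cases hαβ : α = β
    · subst hαβ; rw [hbc x hx α hb, zero_mul]
    · rw [pd_zero (hu β) hx, mul_zero]
      intro t ht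
      refine hbc _ (shift_mem hx α ht) β ?_
      simpa [stdVec, Ne.symm hαβ] using hb)
  have e : ∀ x ∈ unitCube n, ∑ β, pd (fun x => ∑ α, u α x * pd (u β) α x) β x =
      ∑ α, ∑ β, pd (u α) β x ^ 2 - (1/2) * ∑ α, ∑ β, cu u α β x ^ 2 := by
    intro x hx
    have e1 : ∀ β, pd (fun x => ∑ α, u α x * pd (u β) α x) β x =
        ∑ α, (pd (u α) β x * pd (u β) α x + u α x * pd (pd (u β) α) β x) := by
      intro β
      rw [pd_sum Finset.univ (f := fun α x => u α x * pd (u β) α x)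
        (fun α => ContDiff.mul (hu α) ((hu β).pd α))]
      exact Finset.sum_congr rfl fun α _ => pd_mul (hu α) ((hu β).pd α) β x
    have e2 : ∀ α, ∑ β, pd (pd (u β) α) β x = 0 := by
      intro α
      have h1 : ∀ β, pd (pd (u β) α) β x = pd (pd (u β) β) α x := fun β => pd_comm (hu β) _ _ _
      simp_rw [h1]
      rw [← pd_sum _ (fun α => (hu α).pd α)]
      refine pd_zero (ContDiff.sum fun β _ => (hu β).pd β) hx fun t ht => hdiv _ (shift_mem hx α ht)
    simp_rw [e1]
    rw [Finset.sum_comm]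
    have e3 : ∀ α, ∑ β, (pd (u α) β x * pd (u β) α x + u α x * pd (pd (u β) α) β x) =
        ∑ β, pd (u α) β x * pd (u β) α x := by
      intro α
      rw [Finset.sum_add_distrib, ← Finset.mul_sum, e2, mul_zero, add_zero]
    simp_rw [e3]
    have e4 : ∑ α, ∑ β, cu u α β x ^ 2 = ∑ α, ∑ β, pd (u α) β x ^ 2 +
        ∑ α, ∑ β, pd (u β) α x ^ 2 - 2 * ∑ α, ∑ β, pd (u α) β x * pd (u β) α x := by
      simp only [Finset.mul_sum, ← Finset.sum_add_distrib, ← Finset.sum_sub_distrib]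
      refine Finset.sum_congr rfl fun α _ => Finset.sum_congr rfl fun β _ => ?_
      simp only [cu]; ring
    have e5 : ∑ α, ∑ β, pd (u β) α x ^ 2 = ∑ α, ∑ β, pd (u α) β x ^ 2 := Finset.sum_comm
    rw [e4, e5]; ring
  rw [setIntegral_congr_fun Q_meas e, integral_sub, integral_const_mul] at h
  · linarith
  · exact intQ (continuous_finsetSum _ fun α _ => continuous_finsetSum _ fun β _ => (hpc α β).pow 2)
  · exact (intQ (continuous_finsetSum _ fun α _ => continuous_finsetSum _ fun β _ =>
      (hcc α β).pow 2)).const_mul _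

lemma poincare {u : Fin n → E → ℝ} (hu : ∀ α, Sm (u α))
    (hbc : ∀ x ∈ unitCube n, ∀ α, (x α = 0 ∨ x α = 1) → u α x = 0) (α : Fin n) :
    ∫ x in unitCube n, u α x ^ 2 ≤ 4 * ∫ x in unitCube n, pd (u α) α x ^ 2 := by
  have hpc := (hu α).pd α |>.cont
  have huc := (hu α).cont
  have hs : Sm (fun x : E => x α * (u α x * u α x)) :=
    ContDiff.mul (coord_sm α) (ContDiff.mul (hu α) (hu α))
  have h := divQ (X := fun β x => if β = α then x α * (u α x * u α x) else 0) (by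
      intro β
      by_cases h : β = α
      · simp only [h, if_true]; exact hs
      · simp only [h, if_false]; exact contDiff_const) (by
      intro x hx β hb
      by_cases h : β = α
      · subst h; simp [hbc x hx β hb]
      · simp [h])
  have e : ∀ x, ∑ β, pd (fun x => if β = α then x α * (u α x * u α x) else 0) β x =
      u α x ^ 2 + 2 * (x α * u α x * pd (u α) α x) := by
    intro x
    rw [Finset.sum_eq_single α]
    · simp only [if_true]
      rw [pd_mul (coord_sm α) (ContDiff.mul (hu α) (hu α)), pd_mul (hu α) (hu α)]
      have : pd (fun y : E => y α) α x = 1 := by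
        have hd : HasFDerivAt (fun y : E => y α) (EuclideanSpace.proj α : E →L[ℝ] ℝ) x :=
          (EuclideanSpace.proj α : E →L[ℝ] ℝ).hasFDerivAt
        simp [pd, hd.fderiv, stdVec]
      rw [this]; ring
    · intro β _ hb; simp [hb, pd]
    · simp
  simp_rw [e] at h
  have i1 : IntegrableOn (fun x => u α x ^ 2) (unitCube n) := intQ (by fun_prop)
  have i2 : IntegrableOn (fun x => pd (u α) α x ^ 2) (unitCube n) := intQ (by fun_prop)
  have i3 : IntegrableOn (fun x => 2 * (x α * u α x * pd (u α) α x)) (unitCube n) :=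
    intQ (by fun_prop)
  rw [integral_add i1 i3] at h
  have i4 : IntegrableOn (fun x => (1/2) * u α x ^ 2 + 2 * pd (u α) α x ^ 2) (unitCube n) :=
    intQ (by fun_prop)
  have k : ∫ x in unitCube n, -(2 * (x α * u α x * pd (u α) α x)) ≤
      ∫ x in unitCube n, ((1/2) * u α x ^ 2 + 2 * pd (u α) α x ^ 2) := by
    refine setIntegral_mono_on i3.neg i4 Q_meas fun x hx => ?_
    have h0 := (hx α).1
    have h1 := (hx α).2
    have hx2 : x α ^ 2 ≤ 1 := by nlinarith
    nlinarith [sq_nonneg (u α x + 2 * x α * pd (u α) α x), sq_nonneg (pd (u α) α x),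
      mul_le_mul_of_nonneg_right hx2 (sq_nonneg (pd (u α) α x))]
  rw [integral_neg, integral_add (i1.const_mul _) (i2.const_mul _), integral_const_mul,
    integral_const_mul, integral_const_mul] at k
  rw [integral_const_mul] at h
  linarith



/-- Triangle wave. -/
noncomputable def tri (t : ℝ) : ℝ := ‖(t : AddCircle (2:ℝ))‖

/-- Sign wave. -/
noncomputable def sg (t : ℝ) : ℝ := if Even ⌊t⌋ then 1 else -1

lemma tri_nonneg (t : ℝ) : 0 ≤ tri t := norm_nonneg _

lemma tri_le (t : ℝ) : tri t ≤ 1 := by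
  have := AddCircle.norm_le_half_period (2:ℝ) (x := (t : AddCircle (2:ℝ))) (by norm_num)
  norm_num at this; exact this

lemma tri_small {s : ℝ} (hs : |s| ≤ 1) : tri s = |s| := by
  rw [tri, AddCircle.norm_coe_eq_abs_iff (2:ℝ) (by norm_num)]
  norm_num; exact hs

lemma tri_lip (s t : ℝ) : |tri s - tri t| ≤ |s - t| := by
  unfold tri
  refine (abs_norm_sub_norm_le _ _).trans ?_
  rw [← AddCircle.coe_sub]
  by_cases h : |s - t| ≤ 1
  · exact (tri_small h).le
  · exact (tri_le _).trans (not_le.1 h).le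

lemma tri_per (j : ℤ) (s : ℝ) : tri (2 * j + s) = tri s := by
  unfold tri
  congr 1
  rw [AddCircle.coe_add]
  have : (((2 * j : ℝ)) : AddCircle (2:ℝ)) = 0 := by
    rw [AddCircle.coe_eq_zero_iff]; exact ⟨j, by simp [mul_comm]⟩
  rw [this, zero_add]

lemma tri_even {k : ℤ} (hk : Even k) {s : ℝ} (h0 : (k:ℝ) ≤ s) (h1 : s ≤ k + 1) :
    tri s = s - k := by
  obtain ⟨j, rfl⟩ := hk
  push_cast at h0 h1 ⊢
  have : s = 2 * j + (s - (j + j)) := by ring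
  rw [this, tri_per, tri_small (by rw [abs_le]; constructor <;> linarith),
    abs_of_nonneg (by linarith)]
  ring

lemma tri_odd {k : ℤ} (hk : ¬ Even k) {s : ℝ} (h0 : (k:ℝ) ≤ s) (h1 : s ≤ k + 1) :
    tri s = k + 1 - s := by
  obtain ⟨j, rfl⟩ := Int.not_even_iff_odd.1 hk
  push_cast at h0 h1 ⊢
  have : s = 2 * (j + 1 : ℤ) + (s - 2 * (j + 1)) := by push_cast; ring
  rw [this, tri_per, tri_small (by rw [abs_le]; constructor <;> linarith),
    abs_of_nonpos (by linarith)]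
  push_cast; ring

lemma tri_int (k : ℤ) : tri k = 0 ∨ tri k = 1 := by
  by_cases hk : Even k
  · left; rw [tri_even hk le_rfl (by linarith)]; ring
  · right; rw [tri_odd hk le_rfl (by linarith)]; ring

lemma sg_sq (t : ℝ) : sg t * sg t = 1 := by unfold sg; split_ifs <;> norm_num

lemma sg_abs (t : ℝ) : |sg t| = 1 := by unfold sg; split_ifs <;> norm_num

lemma tri_cell (t s : ℝ) (h : ⌊s⌋ = ⌊t⌋) : tri s = tri t + sg t * (s - t) := by
  have h1 := Int.floor_le s
  have h2 := (Int.lt_floor_add_one s).le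
  have h3 := Int.floor_le t
  have h4 := (Int.lt_floor_add_one t).le
  rw [h] at h1 h2
  unfold sg
  split_ifs with hk
  · rw [tri_even hk h1 h2, tri_even hk h3 h4]; ring
  · rw [tri_odd hk h1 h2, tri_odd hk h3 h4]; ring

lemma sg_cell (t s : ℝ) (h : ⌊s⌋ = ⌊t⌋) : sg s = sg t := by unfold sg; rw [h]

/-- Folding map. -/
noncomputable def Fo (x : EuclideanSpace ℝ (Fin n)) : EuclideanSpace ℝ (Fin n) :=
  WithLp.toLp 2 (fun i => tri (x i))

@[simp] lemma Fo_apply (x : E) (i : Fin n) : Fo x i = tri (x i) := rfl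

lemma Fo_mem (x : E) : Fo x ∈ unitCube n := fun _ => ⟨tri_nonneg _, tri_le _⟩

lemma Fo_lip (x y : E) : dist (Fo x) (Fo y) ≤ dist x y := by
  rw [EuclideanSpace.dist_eq, EuclideanSpace.dist_eq]
  refine Real.sqrt_le_sqrt (Finset.sum_le_sum fun i _ => ?_)
  refine pow_le_pow_left₀ dist_nonneg ?_ 2
  rw [Real.dist_eq, Real.dist_eq]; exact tri_lip _ _

lemma Fo_cont : Continuous (Fo : E → E) :=
  (LipschitzWith.of_dist_le_mul (K := 1) (by intro x y; simpa using Fo_lip x y)).continuous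

lemma sg_meas : Measurable sg := by
  unfold sg
  refine Measurable.ite ?_ measurable_const measurable_const
  have : MeasurableSet (Int.floor ⁻¹' {k : ℤ | Even k} : Set ℝ) :=
    Int.measurable_floor MeasurableSet.of_discrete
  exact this

lemma Fo_int {x : E} (hx : ∀ i, x i ∈ Set.Ioo (0:ℝ) 1) : Fo x = x ∧ ∀ i, sg (x i) = 1 := by
  have hf : ∀ i, ⌊x i⌋ = 0 := fun i => Int.floor_eq_zero_iff.2 ⟨(hx i).1.le, (hx i).2⟩
  constructor
  · ext i
    rw [Fo_apply, tri_small (by rw [abs_of_pos (hx i).1]; exact (hx i).2.le), abs_of_pos (hx i).1]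
  · intro i; simp [sg, hf]

lemma hyp_null (i : Fin n) (c : ℝ) : volume {y : E | y i = c} = 0 := by
  have h := Measure.pi_hyperplane (fun _ : Fin n => (volume : Measure ℝ)) i c
  rw [← volume_pi] at h
  have hm : MeasurableSet {y : Fin n → ℝ | y i = c} :=
    measurableSet_eq_fun (by fun_prop) measurable_const
  rw [← (PiLp.volume_preserving_ofLp (Fin n)).measure_preimage hm.nullMeasurableSet] at h
  exact h

lemma nonint_ae (x : E) {ε : ℝ} (hε : ε ≠ 0) : ∀ᵐ y : E, ∀ i (k : ℤ), (x - ε • y) i ≠ k := by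
  rw [ae_all_iff]; intro i
  rw [ae_all_iff]; intro k
  have := hyp_null i ((x i - k) / ε)
  rw [ae_iff]
  refine measure_mono_null ?_ this
  intro y hy
  simp only [ne_eq, not_not, Set.mem_ofPred_eq] at hy ⊢
  simp at hy
  rw [eq_div_iff hε]; linarith

lemma Q_ae : ∀ᵐ y : E, y ∈ unitCube n → ∀ i, y i ∈ Set.Ioo (0:ℝ) 1 := by
  have h : ∀ᵐ y : E, ∀ i, y i ≠ 0 ∧ y i ≠ 1 := by
    rw [ae_all_iff]; intro i
    refine Filter.Eventually.and ?_ ?_ <;> rw [ae_iff] <;> simpa using hyp_null i _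
  filter_upwards [h] with y hy hQ i
  exact ⟨lt_of_le_of_ne (hQ i).1 (Ne.symm (hy i).1), lt_of_le_of_ne (hQ i).2 (hy i).2⟩

lemma Fo_cell {x y : E} (h : ∀ i, ⌊y i⌋ = ⌊x i⌋) :
    Fo y = WithLp.toLp 2 (fun i => tri (x i) + sg (x i) * (y i - x i)) := by
  ext i; exact tri_cell _ _ (h i)

lemma mp_aff (a s : Fin n → ℝ) (hs : ∀ i, s i = 1 ∨ s i = -1) :
    MeasurePreserving (fun y : E => (WithLp.toLp 2 (fun i => a i + s i * y i) : E)) := by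
  have h1 : ∀ i, MeasurePreserving (fun t : ℝ => a i + s i * t) := by
    intro i
    rcases hs i with h | h
    · simp only [h, one_mul]; exact measurePreserving_add_left volume (a i)
    · simp only [h, neg_one_mul, ← sub_eq_add_neg]; exact Measure.measurePreserving_sub_left volume (a i)
  exact ((PiLp.volume_preserving_toLp (Fin n)).comp (volume_preserving_pi h1)).comp
    (PiLp.volume_preserving_ofLp (Fin n))

lemma sg_pm (t : ℝ) : sg t = 1 ∨ sg t = -1 := by unfold sg; split_ifs <;> simp

lemma refl_L2 {h : E → ENNReal} (hh : Measurable h) (z : E) {r : ℝ} (hr : r ≤ 1) :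
    ∫⁻ x in ball z r, h (Fo x) ≤ 3 ^ n * ∫⁻ x in ball (Fo z) r ∩ unitCube n, h x := by
  set cell : (Fin n → Fin 3) → Set E := fun e => {x | ∀ i, ⌊x i⌋ = ⌊z i⌋ + ((e i : ℕ) : ℤ) - 1}
    with hcell
  have hcov : ball z r ⊆ ⋃ e, (ball z r ∩ cell e) := by
    intro x hx
    have hd : ∀ i, |x i - z i| < 1 := by
      intro i
      have h1 := EuclideanSpace.norm_eq (x - z)
      have := PiLp.norm_apply_le (x - z) i
      rw [mem_ball_iff_norm] at hx
      simp only [PiLp.sub_apply, Real.norm_eq_abs] at this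
      linarith
    have : ∀ i, ∃ e : Fin 3, ⌊x i⌋ = ⌊z i⌋ + ((e : ℕ) : ℤ) - 1 := by
      intro i
      have h1 := abs_lt.1 (hd i)
      have a1 : ⌊x i⌋ ≤ ⌊z i⌋ + 1 := by
        have : ⌊x i⌋ ≤ ⌊z i + 1⌋ := Int.floor_le_floor (by linarith)
        rwa [Int.floor_add_one] at this
      have a2 : ⌊z i⌋ ≤ ⌊x i⌋ + 1 := by
        have : ⌊z i⌋ ≤ ⌊x i + 1⌋ := Int.floor_le_floor (by linarith)
        rwa [Int.floor_add_one] at this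
      refine ⟨⟨(⌊x i⌋ - ⌊z i⌋ + 1).toNat, by omega⟩, ?_⟩
      simp only
      omega
    choose e he using this
    exact Set.mem_iUnion.2 ⟨e, hx, he⟩
  refine (lintegral_mono_set hcov).trans ((lintegral_iUnion_le _ _).trans ?_)
  rw [tsum_fintype]
  have hone : ∀ e, ∫⁻ x in ball z r ∩ cell e, h (Fo x) ≤ ∫⁻ x in ball (Fo z) r ∩ unitCube n, h x := by
    intro e
    rcases (ball z r ∩ cell e).eq_empty_or_nonempty with he | ⟨x, hxb, hxc⟩
    · rw [he]; simp
    · have hmp := mp_aff (fun i => tri (x i) - sg (x i) * x i) (fun i => sg (x i))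
        (fun i => sg_pm _)
      set G : E → E := fun y => (WithLp.toLp 2
        (fun i => (tri (x i) - sg (x i) * x i) + sg (x i) * y i) : E) with hG
      have hFG : ∀ y ∈ cell e, Fo y = G y := by
        intro y hy
        rw [Fo_cell (x := x) (fun i => (hy i).trans (hxc i).symm)]
        ext i; simp only [hG]; ring
      have hms : MeasurableSet (ball (Fo z) r ∩ unitCube n) := measurableSet_ball.inter Q_meas
      rw [← hmp.setLIntegral_comp_preimage hms hh]
      have hcm : MeasurableSet (cell e) := by
        have : cell e = ⋂ i, (fun x : E => ⌊x i⌋) ⁻¹' {⌊z i⌋ + ((e i : ℕ) : ℤ) - 1} := by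
          ext y; simp [hcell]
        rw [this]
        exact MeasurableSet.iInter fun i =>
          (Int.measurable_floor.comp (by fun_prop)) (measurableSet_singleton _)
      rw [setLIntegral_congr_fun (measurableSet_ball.inter hcm) (fun y hy => by rw [hFG y hy.2])]
      refine lintegral_mono_set fun y hy => ?_
      change G y ∈ ball (Fo z) r ∩ unitCube n
      rw [← hFG y hy.2]
      exact ⟨(Fo_lip y z).trans_lt hy.1, Fo_mem y⟩
  refine (Finset.sum_le_sum fun e _ => hone e).trans (le_of_eq ?_)
  simp



/-- Extension of the 1-form by reflection. -/
noncomputable def ex (u : Fin n → EuclideanSpace ℝ (Fin n) → ℝ) (α : Fin n) :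
    EuclideanSpace ℝ (Fin n) → ℝ := fun x => sg (x α) * u α (Fo x)

/-- Extension of 2-tensors by reflection. -/
noncomputable def ex2 (α β : Fin n) (f : EuclideanSpace ℝ (Fin n) → ℝ) :
    EuclideanSpace ℝ (Fin n) → ℝ := fun x => sg (x α) * sg (x β) * f (Fo x)

lemma Q_convex : Convex ℝ (unitCube n) := by
  intro x hx y hy a b ha hb hab i
  have := (convex_Icc (0:ℝ) 1) (hx i) (hy i) ha hb hab
  simpa using this

lemma Q_lip {f : E → ℝ} (hf : Sm f) : ∃ K : NNReal, ∀ x ∈ unitCube n, ∀ y ∈ unitCube n,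
    |f x - f y| ≤ K * dist x y := by
  have hc : Continuous (fun x => ‖fderiv ℝ f x‖₊) :=
    (ContDiff.continuous_fderiv hf (by simp)).nnnorm
  obtain ⟨K, hK⟩ := (Q_compact (n := n)).bddAbove_image hc.continuousOn
  refine ⟨K, fun x hx y hy => ?_⟩
  have := Q_convex.lipschitzOnWith_of_nnnorm_fderiv_le (𝕜 := ℝ) (fun x _ => hf.diff x)
    (fun x hx => hK (Set.mem_image_of_mem _ hx))
  simpa [Real.dist_eq] using this.dist_le_mul x hx y hy

lemma Q_bdd {f : E → ℝ} (hf : Continuous f) : ∃ K : ℝ, ∀ x ∈ unitCube n, |f x| ≤ K := by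
  obtain ⟨K, hK⟩ := (Q_compact (n := n)).exists_bound_of_continuousOn hf.continuousOn
  exact ⟨K, hK⟩

lemma ex_small {u : Fin n → E → ℝ} (hbc : ∀ x ∈ unitCube n, ∀ α, (x α = 0 ∨ x α = 1) → u α x = 0)
    {α : Fin n} {K : NNReal} (hK : ∀ x ∈ unitCube n, ∀ y ∈ unitCube n,
    |u α x - u α y| ≤ K * dist x y) (x : E) (m : ℤ) : |ex u α x| ≤ K * |x α - m| := by
  set z : E := x + ((m : ℝ) - x α) • stdVec n α with hz
  have hzα : z α = m := by simp [hz, stdVec]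
  have h0 : u α (Fo z) = 0 := by
    refine hbc _ (Fo_mem z) α ?_
    rw [Fo_apply, hzα]; exact tri_int m
  have h1 := hK _ (Fo_mem x) _ (Fo_mem z)
  rw [h0, sub_zero] at h1
  rw [ex, abs_mul, sg_abs, one_mul]
  refine h1.trans (mul_le_mul_of_nonneg_left ((Fo_lip x z).trans (le_of_eq ?_)) K.2)
  rw [dist_eq_norm, hz, sub_add_cancel_left, norm_neg, norm_smul]
  simp [stdVec]
  exact abs_sub_comm _ _

lemma ex_lip {u : Fin n → E → ℝ} (hu : ∀ α, Sm (u α))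
    (hbc : ∀ x ∈ unitCube n, ∀ α, (x α = 0 ∨ x α = 1) → u α x = 0) (α : Fin n) :
    ∃ K : NNReal, LipschitzWith K (ex u α) := by
  obtain ⟨K, hK⟩ := Q_lip (hu α)
  refine ⟨2 * K, LipschitzWith.of_dist_le_mul ?_⟩
  have main : ∀ x y : E, x α ≤ y α → |ex u α x - ex u α y| ≤ 2 * K * dist x y := by
    intro x y hxy
    by_cases hs : ⌊x α⌋ = ⌊y α⌋
    · have : ex u α x - ex u α y = sg (y α) * (u α (Fo x) - u α (Fo y)) := by
        simp only [ex]; rw [sg_cell _ _ hs]; ring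
      rw [this, abs_mul, sg_abs, one_mul]
      have h1 := hK _ (Fo_mem x) _ (Fo_mem y)
      have h2 := mul_le_mul_of_nonneg_left (Fo_lip x y) K.2
      have h3 : 0 ≤ (K:ℝ) * dist x y := by positivity
      simp only [NNReal.val_eq_coe] at h2
      linarith
    · have hlt : ⌊x α⌋ < ⌊y α⌋ := lt_of_le_of_ne (Int.floor_le_floor hxy) hs
      have h1 := ex_small hbc hK x ⌊y α⌋
      have h2 := ex_small hbc hK y ⌊y α⌋
      have a1 : x α < ⌊y α⌋ := Int.floor_lt.1 hlt
      have a2 := Int.floor_le (y α)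
      have hd : |x α - y α| ≤ dist x y := by
        rw [dist_eq_norm]
        have := PiLp.norm_apply_le (x - y) α
        simpa using this
      rw [abs_of_nonpos (by linarith)] at hd
      rw [abs_of_nonpos (a := x α - (⌊y α⌋:ℝ)) (by linarith)] at h1
      rw [abs_of_nonneg (a := y α - (⌊y α⌋:ℝ)) (by linarith)] at h2
      have h3 : (K:ℝ) * (y α - x α) ≤ K * dist x y :=
        mul_le_mul_of_nonneg_left (by linarith) K.2
      have h4 := abs_sub (ex u α x) (ex u α y)
      have h5 : 0 ≤ (K:ℝ) * dist x y := by positivity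
      nlinarith
  intro x y
  rw [Real.dist_eq]
  push_cast
  rcases le_total (x α) (y α) with h | h
  · exact main x y h
  · rw [abs_sub_comm, dist_comm]; exact main y x h

lemma ex2_meas {f : E → ℝ} (hf : Continuous f) (α β : Fin n) : Measurable (ex2 α β f) := by
  unfold ex2
  have := (hf.comp Fo_cont).measurable
  exact ((sg_meas.comp (by fun_prop)).mul (sg_meas.comp (by fun_prop))).mul this

lemma ex2_abs (f : E → ℝ) (α β : Fin n) (x : E) : |ex2 α β f x| = |f (Fo x)| := by
  rw [ex2, abs_mul, abs_mul, sg_abs, sg_abs, one_mul, one_mul]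

lemma ex_abs (u : Fin n → E → ℝ) (α : Fin n) (x : E) : |ex u α x| = |u α (Fo x)| := by
  rw [ex, abs_mul, sg_abs, one_mul]

lemma int_bdd {κ g : E → ℝ} (hκ : Ker κ) (hg : Measurable g) {K : ℝ} (hK : ∀ x, |g x| ≤ K)
    (ε : ℝ) (x : E) : Integrable (fun y => κ y * g (x - ε • y)) :=
  Integrable.mul_bdd (c := K) (hκ.1.cont.integrable_of_hasCompactSupport hκ.cpt)
    (Measurable.aestronglyMeasurable (by fun_prop)) (Filter.Eventually.of_forall fun _ => hK _)

lemma ex_deriv {u : Fin n → E → ℝ} (hu : ∀ α, Sm (u α)) (α β : Fin n) {w : E}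
    (hw : ∀ i (k : ℤ), w i ≠ k) :
    HasDerivAt (fun t : ℝ => ex u α (w + t • stdVec n β)) (ex2 α β (pd (u α) β) w) 0 := by
  have hloc : ∀ᶠ t : ℝ in nhds 0, ⌊w β + t⌋ = ⌊w β⌋ := by
    have h1 : (⌊w β⌋ : ℝ) < w β + 0 := by
      rw [add_zero]; exact lt_of_le_of_ne (Int.floor_le _) (Ne.symm (hw β _))
    have h2 : w β + 0 < ⌊w β⌋ + 1 := by rw [add_zero]; exact Int.lt_floor_add_one _
    have hc : Continuous (fun t : ℝ => w β + t) := by fun_prop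
    filter_upwards [hc.continuousAt.eventually (lt_mem_nhds h1),
      hc.continuousAt.eventually (gt_mem_nhds h2)] with t ht1 ht2
    rw [Int.floor_eq_iff]; exact ⟨ht1.le, ht2⟩
  have heq : (fun t : ℝ => ex u α (w + t • stdVec n β)) =ᶠ[nhds 0]
      fun t => sg (w α) * u α (Fo w + t • (sg (w β) • stdVec n β)) := by
    filter_upwards [hloc] with t ht
    have hfl : ∀ i, ⌊(w + t • stdVec n β) i⌋ = ⌊w i⌋ := by
      intro i
      by_cases h : i = β
      · subst h; simpa [stdVec] using ht
      · simp [stdVec, h]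
    simp only [ex]
    rw [sg_cell _ _ (hfl α), Fo_cell hfl]
    congr 2
    ext i
    by_cases h : i = β
    · subst h; simp [stdVec, mul_comm]
    · simp [stdVec, h]
  refine HasDerivAt.congr_of_eventuallyEq ?_ heq
  have h1 : HasDerivAt (fun t : ℝ => Fo w + t • (sg (w β) • stdVec n β))
      (sg (w β) • stdVec n β) 0 := by
    simpa using ((hasDerivAt_id (0:ℝ)).smul_const (sg (w β) • stdVec n β)).const_add (Fo w)
  have h2 : HasFDerivAt (u α) (fderiv ℝ (u α) (Fo w)) (Fo w + (0:ℝ) • (sg (w β) • stdVec n β)) := by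
    simpa using ((hu α).diff (Fo w)).hasFDerivAt
  have h3 := (h2.comp_hasDerivAt 0 h1).const_mul (sg (w α))
  have e : ex2 α β (pd (u α) β) w =
      sg (w α) * (fderiv ℝ (u α) (Fo w)) (sg (w β) • stdVec n β) := by
    simp only [ex2, pd, map_smul, smul_eq_mul]; ring
  rw [e]; exact h3

lemma pd_ex {u : Fin n → E → ℝ} (hu : ∀ α, Sm (u α))
    (hbc : ∀ x ∈ unitCube n, ∀ α, (x α = 0 ∨ x α = 1) → u α x = 0) {ρ : E → ℝ} (hρ : Ker ρ)
    {ε : ℝ} (hε : ε ≠ 0) (α β : Fin n) :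
    pd (T ρ (ex u α) ε) β = T ρ (ex2 α β (pd (u α) β)) ε := by
  obtain ⟨K, hK⟩ := ex_lip hu hbc α
  have hec := hK.continuous
  have hρc := hρ.1.cont
  funext x
  refine pd_of_hasDeriv ((T_smooth hρ hε hec).diff x) ?_
  have hgm := ex2_meas ((hu α).pd β).cont α β
  have := (hasDerivAt_integral_of_dominated_loc_of_lip (μ := (volume : Measure E)) (s := Set.univ)
    (x₀ := (0:ℝ)) (F := fun t y => ρ y * ex u α (x + t • stdVec n β - ε • y))
    (F' := fun y => ρ y * ex2 α β (pd (u α) β) (x - ε • y))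
    (bound := fun y => |ρ y| * K) Filter.univ_mem ?_ ?_ ?_ ?_ ?_ ?_).2
  · exact this
  · exact Filter.Eventually.of_forall fun t => Continuous.aestronglyMeasurable (by fun_prop)
  · exact int_cpt hρc hρ.cpt (by fun_prop)
  · exact Measurable.aestronglyMeasurable (by have := hρc.measurable; fun_prop)
  · refine Filter.Eventually.of_forall fun y => LipschitzOnWith.of_dist_le_mul fun s _ t _ => ?_
    rw [Real.dist_eq, ← mul_sub, abs_mul, Real.coe_nnabs, abs_mul, abs_abs, NNReal.abs_eq, mul_assoc]
    refine mul_le_mul_of_nonneg_left ?_ (abs_nonneg _)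
    have := hK.dist_le_mul (x + s • stdVec n β - ε • y) (x + t • stdVec n β - ε • y)
    rw [Real.dist_eq] at this
    refine this.trans (le_of_eq ?_)
    congr 1
    rw [dist_eq_norm, Real.dist_eq]
    have e : x + s • stdVec n β - ε • y - (x + t • stdVec n β - ε • y) = (s - t) • stdVec n β := by
      rw [sub_smul]; abel
    rw [e, norm_smul]; simp [stdVec]
  · exact ((hρc.abs).integrable_of_hasCompactSupport hρ.cpt.abs).mul_const _
  · filter_upwards [nonint_ae x hε] with y hy
    have h1 := (ex_deriv hu α β hy).const_mul (ρ y)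
    have e : (fun t : ℝ => ρ y * ex u α (x + t • stdVec n β - ε • y)) =
      fun t => ρ y * ex u α (x - ε • y + t • stdVec n β) := by
      funext t; congr 2; abel
    rw [e]; exact h1



lemma T_lim {ρ g : E → ℝ} (hρ : Ker ρ) (h1 : ∫ y, ρ y = 1) (hg : Measurable g) {K : ℝ}
    (hK : ∀ x, |g x| ≤ K) {x : E} (hx : ContinuousAt g x) :
    Filter.Tendsto (fun j : ℕ => T ρ g (1 / ((j:ℝ) + 1)) x) Filter.atTop (nhds (g x)) := by
  have hρc := hρ.1.cont
  have e : g x = ∫ y, ρ y * g x := by rw [integral_mul_const, h1, one_mul]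
  rw [e]
  unfold T
  refine tendsto_integral_of_dominated_convergence (fun y => |ρ y| * K) ?_ ?_ ?_ ?_
  · intro j
    exact Measurable.aestronglyMeasurable (by have := hρc.measurable; fun_prop)
  · exact ((hρc.abs).integrable_of_hasCompactSupport hρ.cpt.abs).mul_const _
  · intro j
    refine Filter.Eventually.of_forall fun y => ?_
    rw [Real.norm_eq_abs, abs_mul]
    exact mul_le_mul_of_nonneg_left (hK _) (abs_nonneg _)
  · refine Filter.Eventually.of_forall fun y => ?_
    refine Filter.Tendsto.const_mul _ ?_
    refine hx.tendsto.comp ?_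
    have h2 : Filter.Tendsto (fun j : ℕ => x - (1 / ((j:ℝ) + 1)) • y) Filter.atTop
        (nhds (x - (0:ℝ) • y)) :=
      tendsto_const_nhds.sub (tendsto_one_div_add_atTop_nhds_zero_nat.smul_const y)
    simpa using h2

lemma fatou_ball {ρ g f : E → ℝ} (hρ : Ker ρ) (h1 : ∫ y, ρ y = 1) (hg : Measurable g) {K : ℝ}
    (hK : ∀ x, |g x| ≤ K)
    (hc : ∀ x : E, (∀ i, x i ∈ Set.Ioo (0:ℝ) 1) → ContinuousAt g x ∧ g x = f x) {z : E} {r : ℝ}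
    {M : ENNReal} (hM : ∀ j : ℕ, L2 (T ρ g (1 / ((j:ℝ) + 1))) z r ≤ M) :
    ∫⁻ x in ball z r ∩ unitCube n, ‖f x‖ₑ ^ 2 ≤ M := by
  have hm : ∀ t : ℝ, Measurable (T ρ g t) := fun t =>
    ((T_meas hρ.1.cont.measurable hg).measurable).comp (by fun_prop : Measurable fun x : E => (x, t))
  calc ∫⁻ x in ball z r ∩ unitCube n, ‖f x‖ₑ ^ 2
      ≤ ∫⁻ x in ball z r ∩ unitCube n,
        Filter.liminf (fun j : ℕ => ‖T ρ g (1 / ((j:ℝ) + 1)) x‖ₑ ^ 2) Filter.atTop := by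
        refine lintegral_mono_ae ?_
        refine (ae_restrict_iff' (measurableSet_ball.inter Q_meas)).2 ?_
        filter_upwards [Q_ae (n := n)] with x hx hxm
        obtain ⟨c1, c2⟩ := hc x (hx hxm.2)
        have := (((ENNReal.continuous_pow 2).tendsto _).comp (T_lim hρ h1 hg hK c1).enorm).liminf_eq
        simp only [Function.comp_def] at this
        rw [this, c2]
    _ ≤ Filter.liminf (fun j : ℕ => ∫⁻ x in ball z r ∩ unitCube n,
        ‖T ρ g (1 / ((j:ℝ) + 1)) x‖ₑ ^ 2) Filter.atTop :=
        lintegral_liminf_le fun j => by have := hm (1 / ((j:ℝ) + 1)); fun_prop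
    _ ≤ M := by
        refine Filter.liminf_le_of_le (by isBoundedDefault) fun b hb => ?_
        obtain ⟨j, hj⟩ := hb.exists
        exact hj.trans ((lintegral_mono_set Set.inter_subset_left).trans (hM j))

lemma int_open : IsOpen {x : E | ∀ i, x i ∈ Set.Ioo (0:ℝ) 1} := by
  have : {x : E | ∀ i, x i ∈ Set.Ioo (0:ℝ) 1} = ⋂ i, (fun x : E => x i) ⁻¹' Set.Ioo (0:ℝ) 1 := by
    ext x; simp
  rw [this]
  exact isOpen_iInter_of_finite fun i => isOpen_Ioo.preimage (by fun_prop)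

lemma loc_eq {g f : E → ℝ} (hf : Continuous f)
    (h : ∀ x : E, (∀ i, x i ∈ Set.Ioo (0:ℝ) 1) → g x = f x) :
    ∀ x : E, (∀ i, x i ∈ Set.Ioo (0:ℝ) 1) → ContinuousAt g x ∧ g x = f x := by
  intro x hx
  refine ⟨?_, h x hx⟩
  refine hf.continuousAt.congr ?_
  filter_upwards [int_open.mem_nhds hx] with y hy
  exact (h y hy).symm

lemma ex2_L2 {f : E → ℝ} (hf : Continuous f) (α β : Fin n) (z : E) {r : ℝ} (hr : r ≤ 1) :
    L2 (ex2 α β f) z r ≤ 3 ^ n * ∫⁻ x in ball (Fo z) r ∩ unitCube n, ‖f x‖ₑ ^ 2 := by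
  refine le_trans (le_of_eq ?_) (refl_L2 (h := fun x => ‖f x‖ₑ ^ 2) (by fun_prop) z hr)
  unfold L2
  refine lintegral_congr fun x => ?_
  rw [enorm_sq, enorm_sq, ← sq_abs, ex2_abs, sq_abs]

lemma ex_L2 {u : Fin n → E → ℝ} (hu : ∀ α, Sm (u α)) (α : Fin n) (z : E) {r : ℝ} (hr : r ≤ 1) :
    L2 (ex u α) z r ≤ 3 ^ n * ∫⁻ x in ball (Fo z) r ∩ unitCube n, ‖u α x‖ₑ ^ 2 := by
  have := (hu α).cont
  refine le_trans (le_of_eq ?_) (refl_L2 (h := fun x => ‖u α x‖ₑ ^ 2) (by fun_prop) z hr)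
  unfold L2
  refine lintegral_congr fun x => ?_
  rw [enorm_sq, enorm_sq, ← sq_abs, ex_abs, sq_abs]

theorem core (hn : 0 < n) {lam : ℝ} (hl : lam < n) :
    ∃ C : ℝ, 0 ≤ C ∧ ∀ u : Fin n → E → ℝ, (∀ α, Sm (u α)) →
    (∀ x ∈ unitCube n, ∑ α, pd (u α) α x = 0) →
    (∀ x ∈ unitCube n, ∀ α, (x α = 0 ∨ x α = 1) → u α x = 0) →
    ∀ A, 0 ≤ A → (∀ α β z r, 0 < r → r ≤ 1 →
      ∫⁻ x in ball z r ∩ unitCube n, ‖cu u α β x‖ₑ ^ 2 ≤ ENNReal.ofReal (A^2 * r^lam)) →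
    (∀ α, ∫⁻ x in unitCube n, ‖u α x‖ₑ ^ 2 ≤ ENNReal.ofReal (A ^ 2)) →
    ∀ r, 0 < r → r ≤ 1 / 2 → ∀ α β z,
    ∫⁻ x in ball z r ∩ unitCube n, ‖pd (u α) β x‖ₑ ^ 2 ≤ ENNReal.ofReal (C * A ^ 2 * r ^ lam) ∧
    ∫⁻ x in ball z r ∩ unitCube n, ‖u α x‖ₑ ^ 2 ≤ ENNReal.ofReal (C * A ^ 2 * r ^ lam) := by
  obtain ⟨ρ, -, hρ, -, -, h1, -⟩ := exists_kernel hn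
  obtain ⟨C1, hC1⟩ := T_L2 hρ
  obtain ⟨C2, hC2, hG⟩ := thmG hn hl
  set D : ℝ := C1 * 3 ^ n with hD
  have hD0 : 0 ≤ D := by positivity
  have hDm : ∀ t : ℝ, (C1 : ENNReal) * (3 ^ n * ENNReal.ofReal t) = ENNReal.ofReal (D * t) := by
    intro t
    rw [ENNReal.ofReal_mul hD0, hD, ENNReal.ofReal_mul (NNReal.coe_nonneg C1), ENNReal.ofReal_pow (by norm_num),
      ← mul_assoc]
    congr 2
    · simp
    · simp
  refine ⟨C2 * D, by positivity, fun u hu hdiv hbc A hA hcurl hL r hr hr2 α β z => ?_⟩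
  -- properties of the mollified extension
  have hbd : ∀ f : E → ℝ, Continuous f → ∃ K, ∀ α β x, |ex2 α β f x| ≤ K := by
    intro f hf
    obtain ⟨K, hK⟩ := Q_bdd hf
    exact ⟨K, fun α β x => by rw [ex2_abs]; exact hK _ (Fo_mem x)⟩
  have hiN : ∀ f : E → ℝ, Continuous f → ∀ α β (ε : ℝ) x,
      Integrable (fun y => ρ y * ex2 α β f (x - ε • y)) := by
    intro f hf α β ε x
    obtain ⟨K, hK⟩ := hbd f hf
    exact int_bdd hρ (ex2_meas hf α β) (hK α β) ε x
  have key : ∀ ε : ℝ, ε ≠ 0 →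
      L2 (T ρ (ex2 α β (pd (u α) β)) ε) z r ≤ ENNReal.ofReal (C2 * D * A ^ 2 * r ^ lam) ∧
      L2 (T ρ (ex u α) ε) z r ≤ ENNReal.ofReal (C2 * D * A ^ 2 * r ^ lam) := by
    intro ε hε
    have hsm : ∀ α, Sm (T ρ (ex u α) ε) := fun α => by
      obtain ⟨K, hK⟩ := ex_lip hu hbc α
      exact T_smooth hρ hε hK.continuous
    have hpd := fun α β => pd_ex hu hbc hρ hε α β
    have hsq : (A * √D) ^ 2 = D * A ^ 2 := by rw [mul_pow, Real.sq_sqrt hD0, mul_comm]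
    have := hG (fun α => T ρ (ex u α) ε) hsm ?_ (A * √D) (by positivity) ?_ ?_ r hr hr2 α β z
    · rw [hsq, hpd α β] at this
      simpa only [mul_assoc] using this
    · intro x
      simp only [hpd]
      unfold T
      rw [← integral_finsetSum _ (fun α _ => hiN _ ((hu α).pd α).cont α α ε x)]
      rw [← integral_zero E ℝ (μ := volume)]
      congr 1
      funext y
      rw [← Finset.mul_sum]
      have : ∑ α, ex2 α α (pd (u α) α) (x - ε • y) = 0 := by
        rw [← hdiv _ (Fo_mem (x - ε • y))]
        refine Finset.sum_congr rfl fun α _ => ?_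
        rw [ex2, sg_sq, one_mul]
      rw [this, mul_zero]
    · intro α β z r hr hr1
      have e : cu (fun α => T ρ (ex u α) ε) α β = T ρ (ex2 α β (cu u α β)) ε := by
        funext x
        simp only [cu, hpd]
        unfold T
        rw [← integral_sub (hiN _ ((hu α).pd β).cont α β ε x) (hiN _ ((hu β).pd α).cont β α ε x)]
        congr 1
        funext y
        simp only [ex2, cu]; ring
      rw [e, hsq, mul_assoc, ← hDm]
      have hcc := (cu_sm hu α β).cont
      refine hC1 _ (ex2_meas hcc α β) r _ (fun w => ?_) ε z
      exact (ex2_L2 hcc α β w hr1).trans (mul_le_mul_right (hcurl α β _ r hr hr1) _)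
    · intro α z
      rw [hsq, ← hDm]
      obtain ⟨K, hK⟩ := ex_lip hu hbc α
      refine hC1 _ hK.continuous.measurable 1 _ (fun w => ?_) ε z
      refine (ex_L2 hu α w le_rfl).trans (mul_le_mul_right (le_trans ?_ (hL α)) _)
      exact lintegral_mono_set Set.inter_subset_right
  have hεj : ∀ j : ℕ, (1 / ((j:ℝ) + 1)) ≠ 0 := fun j => by positivity
  constructor
  · have hfc := ((hu α).pd β).cont
    obtain ⟨K, hK⟩ := hbd _ hfc
    refine fatou_ball hρ h1 (ex2_meas hfc α β) (hK α β) (loc_eq hfc fun x hx => ?_)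
      fun j => (key _ (hεj j)).1
    obtain ⟨a, b⟩ := Fo_int hx
    rw [ex2, b, b, a, one_mul, one_mul]
  · have hfc := (hu α).cont
    obtain ⟨K, hK⟩ := ex_lip hu hbc α
    obtain ⟨K', hK'⟩ := Q_bdd hfc
    refine fatou_ball (K := K') hρ h1 hK.continuous.measurable
      (fun x => by rw [ex_abs]; exact hK' _ (Fo_mem x)) (loc_eq hfc fun x hx => ?_)
      fun j => (key _ (hεj j)).2
    obtain ⟨a, b⟩ := Fo_int hx
    rw [ex, b, a, one_mul]



lemma term_eq {S : E → ℝ} (hS0 : ∀ x, 0 ≤ S x) (q : ℝ) (x₀ : E) {r : ℝ}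
    (hr : 0 < r) :
    r ^ ((n : ℝ) * (1/q - 1/2)) *
      (∫ y in ball x₀ r ∩ unitCube n, |√(S y)| ^ (2:ℝ)) ^ (1/(2:ℝ)) =
    √(r ^ (-((n:ℝ) - 2 * n / q)) * ∫ y in ball x₀ r ∩ unitCube n, S y) := by
  have e : ∀ y, |√(S y)| ^ (2:ℝ) = S y := by
    intro y
    rw [Real.rpow_two, sq_abs, Real.sq_sqrt (hS0 y)]
  simp only [e]
  rw [Real.sqrt_mul (by positivity), ← Real.sqrt_eq_rpow, Real.sqrt_eq_rpow (r ^ _),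
    ← Real.rpow_mul hr.le]
  congr 2
  ring

lemma mor_lower {S : E → ℝ} (hS : Continuous S) (hS0 : ∀ x, 0 ≤ S x) {q : ℝ} (hq : 1 < q) :
    0 ≤ morreyNorm n q 2 (unitCube n) (fun x => √(S x)) ∧ ∀ (x₀ : E) (r : ℝ), 0 < r → r ≤ 1 →
    ∫ y in ball x₀ r ∩ unitCube n, S y ≤
      morreyNorm n q 2 (unitCube n) (fun x => √(S x)) ^ 2 * r ^ ((n:ℝ) - 2 * n / q) := by
  obtain ⟨K, hK⟩ := Q_bdd hS
  have hbound : ∀ (x₀ : E) (r : ℝ), 0 < r → r ≤ 1 →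
      √(r ^ (-((n:ℝ) - 2 * n / q)) * ∫ y in ball x₀ r ∩ unitCube n, S y) ≤ √(|K| * vB n) := by
    intro x₀ r hr hr1
    apply Real.sqrt_le_sqrt
    have h1 : ∫ y in ball x₀ r ∩ unitCube n, S y ≤ |K| * (r ^ n * vB n) := by
      have h2 := norm_setIntegral_le_of_norm_le_const (μ := volume) (f := S)
        (s := ball x₀ r ∩ unitCube n) (C := |K|)
        (lt_of_le_of_lt (measure_mono Set.inter_subset_left) measure_ball_lt_top)
        (fun x hx => (hK x hx.2).trans (le_abs_self K))
      refine (le_abs_self _).trans (h2.trans (mul_le_mul_of_nonneg_left ?_ (abs_nonneg _)))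
      refine (measureReal_mono Set.inter_subset_left measure_ball_lt_top.ne).trans (le_of_eq ?_)
      rw [Measure.real, Measure.addHaar_ball_of_pos _ _ hr, ← vB_eq, ENNReal.toReal_mul,
        ENNReal.toReal_ofReal (by positivity)]
      simp
    have h3 : r ^ (-((n:ℝ) - 2 * n / q)) * r ^ n ≤ 1 := by
      rw [← Real.rpow_natCast r n, ← Real.rpow_add hr]
      refine Real.rpow_le_one hr.le hr1 ?_
      have : 0 ≤ 2 * (n:ℝ) / q := by positivity
      linarith
    have h4 : 0 ≤ r ^ (-((n:ℝ) - 2 * n / q)) := by positivity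
    calc _ ≤ r ^ (-((n:ℝ) - 2 * n / q)) * (|K| * (r ^ n * vB n)) :=
          mul_le_mul_of_nonneg_left h1 h4
      _ = (r ^ (-((n:ℝ) - 2 * n / q)) * r ^ n) * (|K| * vB n) := by ring
      _ ≤ 1 * (|K| * vB n) := mul_le_mul_of_nonneg_right h3 (by positivity)
      _ = _ := one_mul _
  set t : E → Set.Ioc (0:ℝ) 1 → ℝ := fun x₀ r => (r : ℝ) ^ ((n : ℝ) * (1/q - 1/2)) *
      (∫ y in ball x₀ (r : ℝ) ∩ unitCube n, |√(S y)| ^ (2:ℝ)) ^ (1/(2:ℝ)) with ht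
  have hN : morreyNorm n q 2 (unitCube n) (fun x => √(S x)) = ⨆ x₀, ⨆ r, t x₀ r := rfl
  have ht1 : ∀ x₀ r, t x₀ r = √((r:ℝ) ^ (-((n:ℝ) - 2 * n / q)) *
      ∫ y in ball x₀ (r:ℝ) ∩ unitCube n, S y) := fun x₀ r => term_eq hS0 q x₀ r.2.1
  have ht2 : ∀ x₀ r, t x₀ r ≤ √(|K| * vB n) := fun x₀ r => by
    rw [ht1]; exact hbound x₀ r r.2.1 r.2.2
  have ht0 : ∀ x₀ r, 0 ≤ t x₀ r := fun x₀ r => by rw [ht1]; positivity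
  have b1 : ∀ x₀, BddAbove (Set.range (t x₀)) := fun x₀ =>
    ⟨√(|K| * vB n), by rintro _ ⟨r, rfl⟩; exact ht2 x₀ r⟩
  have b2 : BddAbove (Set.range fun x₀ => ⨆ r, t x₀ r) :=
    ⟨√(|K| * vB n), by rintro _ ⟨x₀, rfl⟩; exact Real.iSup_le (ht2 x₀) (by positivity)⟩
  have hle : ∀ x₀ r, t x₀ r ≤ ⨆ x₀, ⨆ r, t x₀ r := fun x₀ r =>
    (le_ciSup (b1 x₀) r).trans (le_ciSup b2 x₀)
  rw [hN]
  refine ⟨Real.iSup_nonneg fun x₀ => Real.iSup_nonneg fun r => ht0 x₀ r, fun x₀ r hr hr1 => ?_⟩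
  have h := hle x₀ ⟨r, hr, hr1⟩
  have hI : 0 ≤ ∫ y in ball x₀ r ∩ unitCube n, S y := integral_nonneg fun y => hS0 y
  have h2 := pow_le_pow_left₀ (ht0 _ _) h 2
  rw [ht1, Real.sq_sqrt (by positivity)] at h2
  simp only at h2
  rw [Real.rpow_neg hr.le, inv_mul_le_iff₀ (by positivity)] at h2
  rw [mul_comm]; exact h2

lemma mor_upper {S : E → ℝ} (hS0 : ∀ x, 0 ≤ S x) {q : ℝ} {B : ℝ} (hB : 0 ≤ B)
    (h : ∀ (x₀ : E) (r : ℝ), 0 < r → r ≤ 1 →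
    ∫ y in ball x₀ r ∩ unitCube n, S y ≤ B ^ 2 * r ^ ((n:ℝ) - 2 * n / q)) :
    morreyNorm n q 2 (unitCube n) (fun x => √(S x)) ≤ B := by
  refine Real.iSup_le (fun x₀ => Real.iSup_le (fun r => ?_) hB) hB
  have hr := r.2.1
  refine (term_eq hS0 q x₀ hr).trans_le ?_
  rw [Real.sqrt_le_left hB, Real.rpow_neg hr.le, inv_mul_le_iff₀ (by positivity), mul_comm]
  exact h x₀ r hr r.2.2

lemma lint_eq {f : E → ℝ} (hf : Continuous f) {s : Set E} (hs : s ⊆ unitCube n) :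
    ∫⁻ x in s, ‖f x‖ₑ ^ 2 = ENNReal.ofReal (∫ x in s, f x ^ 2) := by
  rw [ofReal_integral_eq_lintegral_ofReal 
    ((intQ (f := fun x => f x ^ 2) (hf.pow 2)).mono_set hs)
    (Filter.Eventually.of_forall fun x => sq_nonneg _)]
  exact lintegral_congr fun x => enorm_sq _

lemma fd_norm (f : E → ℝ) (x : E) : ‖fderiv ℝ f x‖ ^ 2 ≤ ∑ β, pd f β x ^ 2 := by
  have h : ‖fderiv ℝ f x‖ ≤ √(∑ β, pd f β x ^ 2) := by
    refine ContinuousLinearMap.opNorm_le_bound _ (by positivity) fun v => ?_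
    rw [lin_expand, Real.norm_eq_abs]
    apply abs_le_of_sq_le_sq _ (by positivity)
    rw [mul_pow, Real.sq_sqrt (by positivity), EuclideanSpace.real_norm_sq_eq, mul_comm]
    exact Finset.sum_mul_sq_le_sq_mul_sq _ _ _
  calc _ ≤ √(∑ β, pd f β x ^ 2) ^ 2 := pow_le_pow_left₀ (norm_nonneg _) h 2
    _ = _ := Real.sq_sqrt (by positivity)

lemma lint_union (t : Finset E) (s : E → Set E) (f : E → ENNReal) :
    ∫⁻ x in ⋃ c ∈ t, s c, f x ≤ ∑ c ∈ t, ∫⁻ x in s c, f x := by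
  classical
  induction t using Finset.induction_on with
  | empty => simp
  | insert a t ha ih =>
    rw [Finset.set_biUnion_insert, Finset.sum_insert ha]
    exact (lintegral_union_le _ _ _).trans (by gcongr)

lemma cover : ∃ m : ℕ, ∀ S : E → ℝ, Continuous S → (∀ x, 0 ≤ S x) → ∀ M : ℝ,
    (∀ z, ∫ x in ball z 1 ∩ unitCube n, S x ≤ M) → ∫ x in unitCube n, S x ≤ m * M := by
  obtain ⟨t, -, ht⟩ := (Q_compact (n := n)).elim_nhds_subcover (fun x => ball x 1)
    (fun x _ => ball_mem_nhds x one_pos)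
  refine ⟨t.card, fun S hS hS0 M hM => ?_⟩
  have hne : ∀ s ⊆ unitCube n, ∫⁻ x in s, ENNReal.ofReal (S x) = ENNReal.ofReal (∫ x in s, S x) :=
    fun s hs => (ofReal_integral_eq_lintegral_ofReal ((intQ hS).mono_set hs)
      (Filter.Eventually.of_forall hS0)).symm
  have hM0 : 0 ≤ M := (integral_nonneg fun y => hS0 y).trans (hM 0)
  rw [← ENNReal.ofReal_le_ofReal_iff (by positivity), ← hne _ subset_rfl]
  calc ∫⁻ x in unitCube n, ENNReal.ofReal (S x)
      ≤ ∫⁻ x in ⋃ c ∈ t, (ball c 1 ∩ unitCube n), ENNReal.ofReal (S x) := by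
        refine lintegral_mono_set fun x hx => ?_
        obtain ⟨c, hc⟩ := Set.mem_iUnion.1 (ht hx)
        obtain ⟨hc, hxc⟩ := Set.mem_iUnion.1 hc
        exact Set.mem_iUnion₂.2 ⟨c, hc, hxc, hx⟩
    _ ≤ ∑ c ∈ t, ∫⁻ x in ball c 1 ∩ unitCube n, ENNReal.ofReal (S x) :=
        lint_union t _ _
    _ ≤ ∑ c ∈ t, ENNReal.ofReal M := by
        refine Finset.sum_le_sum fun c _ => ?_
        rw [hne _ Set.inter_subset_right]
        exact ENNReal.ofReal_le_ofReal (hM c)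
    _ = ENNReal.ofReal (t.card * M) := by
        rw [Finset.sum_const, nsmul_eq_mul, ENNReal.ofReal_mul (by positivity),
          ENNReal.ofReal_natCast]

lemma half_pow {lam r : ℝ} (hr : 1 / 2 ≤ r) (hr1 : r ≤ 1) : 1 ≤ (1 + (2:ℝ) ^ lam) * r ^ lam := by
  have hr0 : 0 < r := by linarith
  have p1 : 0 < (2:ℝ) ^ lam := by positivity
  have p2 : 0 < r ^ lam := by positivity
  rcases le_total lam 0 with h | h
  · have := Real.one_le_rpow_of_pos_of_le_one_of_nonpos hr0 hr1 h
    nlinarith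
  · have h1 : (1:ℝ) ≤ (2 * r) ^ lam := Real.one_le_rpow (by linarith) h
    rw [Real.mul_rpow (by norm_num) hr0.le] at h1
    nlinarith



theorem final_est (hn : 0 < n) {q : ℝ} (hq : 1 < q) :
    ∃ k : ℝ, 0 ≤ k ∧ ∀ (u : Fin n → E → ℝ) (φ : Fin n → Fin n → E → ℝ), (∀ α, Sm (u α)) →
      (∀ α β, Sm (φ α β)) → (∀ x ∈ unitCube n, ∀ α β, cu u α β x = φ α β x) →
      (∀ x ∈ unitCube n, ∑ α, pd (u α) α x = 0) →
      (∀ x ∈ unitCube n, ∀ α, (x α = 0 ∨ x α = 1) → u α x = 0) →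
      ∀ N, N = morreyNorm n q 2 (unitCube n) (fun x => √(∑ α, ∑ β, (φ α β x)^2)) →
      0 ≤ N ∧ ∀ (x₀ : E) (r : ℝ), 0 < r → r ≤ 1 → ∀ α,
        (∫ y in ball x₀ r ∩ unitCube n, u α y ^ 2 ≤ k * N ^ 2 * r ^ ((n:ℝ) - 2 * n / q)) ∧
        ∀ β, ∫ y in ball x₀ r ∩ unitCube n, pd (u α) β y ^ 2 ≤
          k * N ^ 2 * r ^ ((n:ℝ) - 2 * n / q) := by
  have hn' : (0:ℝ) < n := by exact_mod_cast hn
  have hl : (n:ℝ) - 2 * n / q < n := by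
    have : 0 < 2 * (n:ℝ) / q := by positivity
    linarith
  generalize hlam : (n:ℝ) - 2 * n / q = lam at *
  obtain ⟨C, hC, hcore⟩ := core hn hl
  obtain ⟨m, hm⟩ := cover (n := n)
  refine ⟨(C + (1 + 2 ^ lam)) * (4 * m + 1), by positivity,
    fun u φ hu hφ hcu hdiv hbc N hNdef => ?_⟩
  have hSc : Continuous (fun x => ∑ α, ∑ β, (φ α β x)^2) := by
    have := fun α β => (hφ α β).cont
    fun_prop
  have hS0 : ∀ x, 0 ≤ ∑ α, ∑ β, (φ α β x)^2 := fun x => by positivity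
  obtain ⟨hN0, hNb⟩ := mor_lower hSc hS0 hq
  rw [← hNdef, hlam] at hNb
  rw [← hNdef] at hN0
  refine ⟨hN0, ?_⟩
  have hpc := fun α β => ((hu α).pd β).cont
  have hcc := fun α β => (cu_sm hu α β).cont
  have huc := fun α => (hu α).cont
  have hQφ : ∫ x in unitCube n, ∑ α, ∑ β, (φ α β x)^2 ≤ m * N ^ 2 := by
    refine hm _ hSc hS0 _ fun z => ?_
    simpa using hNb z 1 one_pos le_rfl
  have hg := gaffney hu hdiv hbc
  have hcφ : ∫ x in unitCube n, ∑ α, ∑ β, cu u α β x ^ 2 =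
      ∫ x in unitCube n, ∑ α, ∑ β, (φ α β x)^2 :=
    setIntegral_congr_fun Q_meas fun x hx => by simp only [hcu x hx]
  have hmN : 0 ≤ m * N ^ 2 := by positivity
  have hpQ : ∀ α β, ∫ x in unitCube n, pd (u α) β x ^ 2 ≤ m * N ^ 2 := by
    intro α β
    have h1 : ∫ x in unitCube n, pd (u α) β x ^ 2 ≤
        ∫ x in unitCube n, ∑ α, ∑ β, pd (u α) β x ^ 2 := by
      refine integral_mono (intQ (by fun_prop)) (intQ (by fun_prop)) fun x => ?_
      exact (Finset.single_le_sum (f := fun β => pd (u α) β x ^ 2) (fun _ _ => sq_nonneg _)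
        (Finset.mem_univ β)).trans (Finset.single_le_sum (f := fun α => ∑ β, pd (u α) β x ^ 2)
          (fun _ _ => Finset.sum_nonneg fun _ _ => sq_nonneg _) (Finset.mem_univ α))
    rw [hcφ] at hg
    linarith
  have hN2 : 0 ≤ N ^ 2 := sq_nonneg _
  have hpQ' : ∀ α β, ∫ x in unitCube n, pd (u α) β x ^ 2 ≤ (4 * m + 1) * N ^ 2 :=
    fun α β => (hpQ α β).trans (by linarith)
  have huQ : ∀ α, ∫ x in unitCube n, u α x ^ 2 ≤ (4 * m + 1) * N ^ 2 := by
    intro α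
    have := poincare hu hbc α
    have := hpQ α α
    linarith
  have hA : (√(4 * m + 1) * N) ^ 2 = (4 * m + 1) * N ^ 2 := by
    rw [mul_pow, Real.sq_sqrt (by positivity)]
  have hcr := hcore u hu hdiv hbc (√(4 * m + 1) * N) (by positivity) ?_ ?_
  · intro x₀ r hr hr1 α
    have hrl : 0 < r ^ lam := by positivity
    have h2l : 0 < (2:ℝ) ^ lam := by positivity
    have hX : 0 ≤ (4 * (m:ℝ) + 1) * N ^ 2 := by positivity
    have gen : ∀ f : E → ℝ, Continuous f → (∫ x in unitCube n, f x ^ 2 ≤ (4 * m + 1) * N ^ 2) →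
        (r ≤ 1 / 2 → ∫⁻ x in ball x₀ r ∩ unitCube n, ‖f x‖ₑ ^ 2 ≤
          ENNReal.ofReal (C * ((4 * m + 1) * N ^ 2) * r ^ lam)) →
        ∫ y in ball x₀ r ∩ unitCube n, f y ^ 2 ≤
          (C + (1 + 2 ^ lam)) * (4 * m + 1) * N ^ 2 * r ^ lam := by
      intro f hf h1 h2
      rcases le_total r (1 / 2) with h | h
      · have h3 := h2 h
        rw [lint_eq hf Set.inter_subset_right, ENNReal.ofReal_le_ofReal_iff (by positivity)] at h3
        refine h3.trans ?_
        have : 0 ≤ (1 + 2 ^ lam) * ((4 * m + 1) * N ^ 2) * r ^ lam := by positivity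
        nlinarith
      · have h3 : ∫ y in ball x₀ r ∩ unitCube n, f y ^ 2 ≤ ∫ x in unitCube n, f x ^ 2 :=
          setIntegral_mono_set (intQ (f := fun x => f x ^ 2) (by fun_prop))
            (Filter.Eventually.of_forall fun x => sq_nonneg _)
            (Filter.Eventually.of_forall fun x hx => hx.2)
        have h4 := mul_le_mul_of_nonneg_left (half_pow (lam := lam) h hr1) hX
        have : 0 ≤ C * ((4 * m + 1) * N ^ 2) * r ^ lam := by positivity
        refine h3.trans (h1.trans ?_)
        nlinarith
    refine ⟨gen _ (huc α) (huQ α) fun h => ?_, fun β => gen _ (hpc α β) (hpQ' α β) fun h => ?_⟩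
    · have := (hcr r hr h α α x₀).2
      rwa [hA] at this
    · have := (hcr r hr h α β x₀).1
      rwa [hA] at this
  · intro α β z r hr hr1
    rw [hA, lint_eq (hcc α β) Set.inter_subset_right]
    apply ENNReal.ofReal_le_ofReal
    have hrl : 0 < r ^ lam := by positivity
    have h1 : ∫ x in ball z r ∩ unitCube n, cu u α β x ^ 2 ≤
        ∫ x in ball z r ∩ unitCube n, ∑ α, ∑ β, (φ α β x)^2 := by
      refine setIntegral_mono_on
        ((intQ (f := fun x => cu u α β x ^ 2) (by fun_prop)).mono_set Set.inter_subset_right)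
        ((intQ hSc).mono_set Set.inter_subset_right) (measurableSet_ball.inter Q_meas) ?_
      intro x hx
      rw [hcu x hx.2]
      exact (Finset.single_le_sum (f := fun β => φ α β x ^ 2) (fun _ _ => sq_nonneg _)
        (Finset.mem_univ β)).trans (Finset.single_le_sum (f := fun α => ∑ β, φ α β x ^ 2)
          (fun _ _ => Finset.sum_nonneg fun _ _ => sq_nonneg _) (Finset.mem_univ α))
    refine h1.trans ((hNb z r hr hr1).trans ?_)
    have : 0 ≤ 4 * (m:ℝ) * N ^ 2 * r ^ lam := by positivity
    nlinarith
  · intro α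
    rw [hA, lint_eq (huc α) subset_rfl]
    exact ENNReal.ofReal_le_ofReal (huQ α)

end MH

/-- elliptic regularity in Morrey spaces for the Hodge system
du = φ, d*u = 0 with normal boundary condition on the cube. -/
theorem morrey_hodge_regularity (n : ℕ) (hn : 4 ≤ n) (q : ℝ) (hq : 1 < q) :
    ∃ C > 0, ∀ (u : Fin n → EuclideanSpace ℝ (Fin n) → ℝ)
      (φ : Fin n → Fin n → EuclideanSpace ℝ (Fin n) → ℝ),
      (∀ α, ContDiff ℝ (⊤ : ℕ∞) (u α)) → (∀ α β, ContDiff ℝ (⊤ : ℕ∞) (φ α β)) →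
      -- Hodge system: ∂^β u^α − ∂^α u^β = φ^{αβ} on the cube
      (∀ x ∈ unitCube n, ∀ α β,
        fderiv ℝ (u α) x (stdVec n β) - fderiv ℝ (u β) x (stdVec n α) = φ α β x) →
      -- divergence free: ∂_α u^α = 0
      (∀ x ∈ unitCube n, ∑ α, fderiv ℝ (u α) x (stdVec n α) = 0) →
      -- normal boundary condition n_α u^α = 0 on the faces of the cube
      (∀ x ∈ unitCube n, ∀ α, (x α = 0 ∨ x α = 1) → u α x = 0) →
      morreyNorm n q 2 (unitCube n) (fun x => Real.sqrt (∑ α, (u α x)^2)) +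
        morreyNorm n q 2 (unitCube n) (fun x => Real.sqrt (∑ α, ‖fderiv ℝ (u α) x‖^2)) ≤
      C * morreyNorm n q 2 (unitCube n)
        (fun x => Real.sqrt (∑ α, ∑ β, (φ α β x)^2)) := by
  obtain ⟨k, hk, hest⟩ := MH.final_est (n := n) (by omega) hq
  refine ⟨2 * √(n * n * k) + 1, by positivity, fun u φ hu hφ hcu hdiv hbc => ?_⟩
  generalize hN : morreyNorm n q 2 (unitCube n) (fun x => √(∑ α, ∑ β, (φ α β x)^2)) = N
  obtain ⟨hN0, hb⟩ := hest u φ hu hφ hcu hdiv hbc N hN.symm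
  have hn1 : (1:ℝ) ≤ n := by exact_mod_cast (by omega : 1 ≤ n)
  have hsq : (√(n * n * k) * N) ^ 2 = n * n * k * N ^ 2 := by
    rw [mul_pow, Real.sq_sqrt (by positivity)]
  have huc := fun α => MH.Sm.cont (hu α)
  have hpc := fun α β => (MH.Sm.pd (hu α) β).cont
  have e1 : morreyNorm n q 2 (unitCube n) (fun x => √(∑ α, (u α x)^2)) ≤ √(n * n * k) * N := by
    refine MH.mor_upper (fun x => by positivity) (by positivity) fun x₀ r hr hr1 => ?_
    have hrl : 0 < r ^ ((n:ℝ) - 2 * n / q) := by positivity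
    rw [hsq, integral_finsetSum _ (fun α _ => (MH.intQ (f := fun x => u α x ^ 2)
      (by have := huc α; fun_prop)).mono_set Set.inter_subset_right)]
    refine (Finset.sum_le_sum fun α _ => (hb x₀ r hr hr1 α).1).trans ?_
    rw [Finset.sum_const, Finset.card_univ, Fintype.card_fin, nsmul_eq_mul]
    have : 0 ≤ n * (k * N ^ 2 * r ^ ((n:ℝ) - 2 * n / q)) := by positivity
    nlinarith
  have e2 : morreyNorm n q 2 (unitCube n) (fun x => √(∑ α, ‖fderiv ℝ (u α) x‖^2)) ≤
      √(n * n * k) * N := by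
    refine MH.mor_upper (fun x => by positivity) (by positivity) fun x₀ r hr hr1 => ?_
    have hrl : 0 < r ^ ((n:ℝ) - 2 * n / q) := by positivity
    have hfc : ∀ α, Continuous (fun x => fderiv ℝ (u α) x) := fun α =>
      (hu α).continuous_fderiv (by simp)
    have hi : ∀ α β, IntegrableOn (fun x => MH.pd (u α) β x ^ 2) (ball x₀ r ∩ unitCube n) :=
      fun α β => (MH.intQ (f := fun x => MH.pd (u α) β x ^ 2)
        (by have := hpc α β; fun_prop)).mono_set Set.inter_subset_right
    have h1 : ∫ y in ball x₀ r ∩ unitCube n, ∑ α, ‖fderiv ℝ (u α) y‖^2 ≤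
        ∫ y in ball x₀ r ∩ unitCube n, ∑ α, ∑ β, MH.pd (u α) β y ^ 2 := by
      refine integral_mono ((MH.intQ (by fun_prop)).mono_set Set.inter_subset_right)
        ((MH.intQ (by fun_prop)).mono_set Set.inter_subset_right) fun x => ?_
      exact Finset.sum_le_sum fun α _ => MH.fd_norm _ _
    refine h1.trans ?_
    rw [hsq, integral_finsetSum _ (fun α _ => integrable_finsetSum _ fun β _ => hi α β)]
    have h2 : ∀ α, ∫ y in ball x₀ r ∩ unitCube n, ∑ β, MH.pd (u α) β y ^ 2 ≤
        n * (k * N ^ 2 * r ^ ((n:ℝ) - 2 * n / q)) := by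
      intro α
      rw [integral_finsetSum _ fun β _ => hi α β]
      refine (Finset.sum_le_sum fun β _ => (hb x₀ r hr hr1 α).2 β).trans ?_
      rw [Finset.sum_const, Finset.card_univ, Fintype.card_fin, nsmul_eq_mul]
    refine (Finset.sum_le_sum fun α _ => h2 α).trans (le_of_eq ?_)
    rw [Finset.sum_const, Finset.card_univ, Fintype.card_fin, nsmul_eq_mul]
    ring
  linarith
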